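/- Let p > 2, q₀ ∈ (0,∞), and let ℋ = ℋ(q₀, p, 𝔹) be the class of all Q-homeomorphisms f : 𝔹 → ℂ with respect to the p-modulus (𝔹 the open unit disc) whose function Q satisfies q(t) ≤ q₀ for almost every t ∈ (0,1), where q(t) = (1/(2πt)) ∫_{S_t} Q(z) |dz| is the integral mean of Q over the circle S_t = {z : |z| = t}. Consider the area functional S_r(f) = |f(B_r)|, where B_r = {z ∈ ℂ : |z| ≤ r}. Then for every r ∈ [0,1], min_{f ∈ ℋ} S_r(f) = π · q₀^{2/(2−p)} · r², and the minimum is attained by the linear mapping f₀(z) = q₀^{1/(2−p)} · z. -/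

import Mathlib

open MeasureTheory Set Metric Complex ENNReal

noncomputable section

open Classical in
/-- The line integral `∫_γ ρ |dz|` of a Borel density `ρ` along a curve `γ`
(parametrized on `[0,1]`), with the convention that the integral is `∞`
for curves that are not rectifiable (here: not Lipschitz on `[0,1]`). -/
def lineIntegral (ρ : ℂ → ℝ≥0∞) (γ : ℝ → ℂ) : ℝ≥0∞ :=
  if ∃ K : NNReal, LipschitzOnWith K γ (Set.Icc 0 1) then
    ∫⁻ t in Set.Icc (0 : ℝ) 1, ρ (γ t) * (‖deriv γ t‖₊ : ℝ≥0∞)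
  else ⊤

/-- A Borel function `ρ : ℂ → [0,∞]` is admissible for the curve family `Γ`
if `∫_γ ρ |dz| ≥ 1` for every `γ ∈ Γ`. -/
def IsAdmissible (ρ : ℂ → ℝ≥0∞) (Γ : Set (ℝ → ℂ)) : Prop :=
  Measurable ρ ∧ ∀ γ ∈ Γ, 1 ≤ lineIntegral ρ γ

/-- The `p`-modulus of a family `Γ` of curves in `ℂ`:
`M_p(Γ) = inf { ∫_ℂ ρ^p dm : ρ admissible for Γ }`. -/
def pModulus (p : ℝ) (Γ : Set (ℝ → ℂ)) : ℝ≥0∞ :=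
  ⨅ (ρ : ℂ → ℝ≥0∞) (_ : IsAdmissible ρ Γ), ∫⁻ z : ℂ, ρ z ^ p

/-- `Γ` is a family of curves lying in the set `D`. -/
def CurveFamilyIn (Γ : Set (ℝ → ℂ)) (D : Set ℂ) : Prop :=
  ∀ γ ∈ Γ, ContinuousOn γ (Set.Icc 0 1) ∧ ∀ t ∈ Set.Icc (0 : ℝ) 1, γ t ∈ D

/-- `f` is a homeomorphism of `D` onto its image: continuous, injective and open on `D`. -/
def IsHomeoOn (f : ℂ → ℂ) (D : Set ℂ) : Prop :=
  ContinuousOn f D ∧ Set.InjOn f D ∧ ∀ U ⊆ D, IsOpen U → IsOpen (f '' U)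

/-- `f` is a `Q`-homeomorphism with respect to the `p`-modulus on `D`:
`M_p(fΓ) ≤ ∫_D Q(z) ρ(z)^p dm(z)` for every curve family `Γ` in `D` and every
`ρ` admissible for `Γ`. -/
def IsQHomeo (p : ℝ) (D : Set ℂ) (Q : ℂ → ℝ≥0∞) (f : ℂ → ℂ) : Prop :=
  IsHomeoOn f D ∧
    ∀ Γ : Set (ℝ → ℂ), CurveFamilyIn Γ D → ∀ ρ : ℂ → ℝ≥0∞, IsAdmissible ρ Γ →
      pModulus p ((fun γ => f ∘ γ) '' Γ) ≤ ∫⁻ z in D, Q z * ρ z ^ p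

/-- The integral mean `q_{z₀}(r) = (1/(2πr)) ∫_{S(z₀,r)} Q(z) |dz|` of `Q` over the
circle `S(z₀,r)`, computed via the arclength parametrization `θ ↦ z₀ + r e^{iθ}`. -/
def circleMean (Q : ℂ → ℝ≥0∞) (z₀ : ℂ) (r : ℝ) : ℝ≥0∞ :=
  (∫⁻ θ in Set.Icc (0 : ℝ) (2 * Real.pi),
      Q (z₀ + (r : ℂ) * Complex.exp ((θ : ℂ) * Complex.I))) / ENNReal.ofReal (2 * Real.pi)

section Pointwise

open scoped Pointwise

theorem IsCompact.volume_add_volume_le_volume_add {K L : Set ℝ} (hK : IsCompact K)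
    (hL : IsCompact L) (hK₀ : K.Nonempty) (hL₀ : L.Nonempty) :
    volume K + volume L ≤ volume (K + L) := by
  have hsub : ((sInf L) +ᵥ K) ∪ ((sSup K) +ᵥ L) ⊆ K + L := by
    rintro x (⟨k, hk, rfl⟩ | ⟨l, hl, rfl⟩)
    · exact ⟨k, hk, sInf L, hL.sInf_mem hL₀, add_comm _ _⟩
    · exact ⟨sSup K, hK.sSup_mem hK₀, l, hl, rfl⟩
  have hdisj : AEDisjoint volume ((sInf L) +ᵥ K) ((sSup K) +ᵥ L) := by
    refine measure_mono_null (t := {sSup K + sInf L}) ?_ (by simp)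
    rintro x ⟨⟨k, hk, rfl⟩, ⟨l, hl, h⟩⟩
    have h1 := le_csSup hK.bddAbove hk
    have h2 := csInf_le hL.bddBelow hl
    simp only [vadd_eq_add, mem_singleton_iff] at h ⊢
    linarith
  calc volume K + volume L = volume (((sInf L) +ᵥ K) ∪ ((sSup K) +ᵥ L)) := by
        rw [measure_union₀ (hL.vadd _).measurableSet.nullMeasurableSet hdisj]
        simp
    _ ≤ _ := measure_mono hsub

/-- The one-dimensional Brunn-Minkowski inequality. -/
theorem Real.volume_add_volume_le_volume_add {A B : Set ℝ} (hA : MeasurableSet A)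
    (hB : MeasurableSet B) (hA₀ : A.Nonempty) (hB₀ : B.Nonempty) :
    volume A + volume B ≤ volume (A + B) := by
  obtain ⟨a, ha⟩ := hA₀
  obtain ⟨b, hb⟩ := hB₀
  have key : ∀ K ⊆ A, IsCompact K → ∀ L ⊆ B, IsCompact L →
      volume K + volume L ≤ volume (A + B) := fun K hKA hK L hLB hL ↦
    calc volume K + volume L ≤ volume (insert a K) + volume (insert b L) := by
          gcongr <;> exact subset_insert _ _
      _ ≤ volume (insert a K + insert b L) :=
          (hK.insert a).volume_add_volume_le_volume_add (hL.insert b) (insert_nonempty _ _)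
            (insert_nonempty _ _)
      _ ≤ _ := measure_mono (add_subset_add (insert_subset ha hKA) (insert_subset hb hLB))
  refine le_of_forall_lt fun c hc ↦ ?_
  rcases eq_or_ne (volume A) 0 with h0 | h0
  · rw [h0, zero_add] at hc
    obtain ⟨L, hLB, hL, hcL⟩ := hB.exists_lt_isCompact hc
    exact hcL.trans_le (by simpa using key ∅ (empty_subset _) isCompact_empty L hLB hL)
  rcases eq_or_ne (volume B) 0 with h1 | h1
  · rw [h1, add_zero] at hc
    obtain ⟨L, hLB, hL, hcL⟩ := hA.exists_lt_isCompact hc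
    exact hcL.trans_le (by simpa using key L hLB hL ∅ (empty_subset _) isCompact_empty)
  obtain ⟨c₁, h₁, c₂, h₂, hc'⟩ := ENNReal.exists_lt_add_of_lt_add hc h0 h1
  obtain ⟨K, hKA, hK, hcK⟩ := hA.exists_lt_isCompact h₁
  obtain ⟨L, hLB, hL, hcL⟩ := hB.exists_lt_isCompact h₂
  exact hc'.trans_le ((add_le_add hcK.le hcL.le).trans (key K hKA hK L hLB hL))

theorem lintegral_eq_mul_lintegral_Ioo_meas {f : ℝ → ℝ≥0∞} (hf : Measurable f) {M : ℝ}
    (hM : 0 < M) (hfM : ∀ x, f x ≤ ENNReal.ofReal M) :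
    ∫⁻ x, f x = ENNReal.ofReal M *
      ∫⁻ t in Ioo (0 : ℝ) 1, volume {x | ENNReal.ofReal (t * M) < f x} := by
  have hf' : ∀ x, f x = ENNReal.ofReal M * ENNReal.ofReal ((f x).toReal / M) := fun x ↦ by
    rw [← ENNReal.ofReal_mul hM.le, mul_div_cancel₀ _ hM.ne',
      ENNReal.ofReal_toReal ((hfM x).trans_lt ENNReal.ofReal_lt_top).ne]
  have hset : ∀ t, 0 < t → {x | t < (f x).toReal / M} = {x | ENNReal.ofReal (t * M) < f x} := by
    intro t ht
    ext x
    rw [mem_ofPred_eq, mem_ofPred_eq, lt_div_iff₀ hM,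
      ENNReal.ofReal_lt_iff_lt_toReal (by positivity)
        ((hfM x).trans_lt ENNReal.ofReal_lt_top).ne]
  calc ∫⁻ x, f x = ENNReal.ofReal M * ∫⁻ x, ENNReal.ofReal ((f x).toReal / M) := by
        rw [← lintegral_const_mul _ (by fun_prop)]
        exact lintegral_congr hf'
    _ = ENNReal.ofReal M * ∫⁻ t in Ioi (0 : ℝ), volume {x | ENNReal.ofReal (t * M) < f x} := by
        rw [lintegral_eq_lintegral_meas_lt _ (ae_of_all _ fun x ↦ by positivity) (by fun_prop)]
        congr 1
        exact setLIntegral_congr_fun measurableSet_Ioi fun t ht ↦ by rw [hset t ht]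
    _ = _ := by
        congr 1
        rw [← lintegral_indicator measurableSet_Ioi, ← lintegral_indicator measurableSet_Ioo]
        refine lintegral_congr fun t ↦ ?_
        by_cases h0 : 0 < t
        · by_cases h1 : t < 1
          · rw [indicator_of_mem (mem_Ioi.2 h0), indicator_of_mem (mem_Ioo.2 ⟨h0, h1⟩)]
          · rw [indicator_of_mem (mem_Ioi.2 h0), indicator_of_notMem (by simp [h1])]
            convert measure_empty (μ := volume)
            refine eq_empty_of_forall_notMem fun x hx ↦ (hfM x).not_gt (lt_of_le_of_lt ?_ hx)
            gcongr
            nlinarith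
        · rw [indicator_of_notMem (by simpa using h0), indicator_of_notMem (by simp [h0])]

theorem mul_lintegral_Ioo_meas_le {f : ℝ → ℝ≥0∞} (hf : Measurable f) {M : ℝ} (hM : 0 < M) :
    ENNReal.ofReal M * ∫⁻ t in Ioo (0 : ℝ) 1, volume {x | ENNReal.ofReal (t * M) < f x} ≤
      ∫⁻ x, f x := by
  calc _ = ENNReal.ofReal M * ∫⁻ t in Ioo (0 : ℝ) 1,
        volume {x | ENNReal.ofReal (t * M) < min (f x) (ENNReal.ofReal M)} := by
        congr 1
        refine setLIntegral_congr_fun measurableSet_Ioo fun t ht ↦ ?_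
        have : ENNReal.ofReal (t * M) < ENNReal.ofReal M :=
          (ENNReal.ofReal_lt_ofReal_iff hM).2 (by nlinarith [ht.2])
        simp [this]
    _ = ∫⁻ x, min (f x) (ENNReal.ofReal M) :=
        (lintegral_eq_mul_lintegral_Ioo_meas (by fun_prop) hM fun x ↦ min_le_right _ _).symm
    _ ≤ _ := lintegral_mono fun x ↦ min_le_left _ _

theorem Real.volume_prod_add_le {A B : Set (ℝ × ℝ)} (hA : IsOpen A) (hB : IsOpen B)
    (hA₀ : A.Nonempty) (hB₀ : B.Nonempty) (hAb : Bornology.IsBounded A)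
    (hBb : Bornology.IsBounded B) :
    volume.real A + volume.real B + 2 * √(volume.real A * volume.real B) ≤
      volume.real (A + B) := by
  set f : ℝ → ℝ≥0∞ := fun x ↦ volume (Prod.mk x ⁻¹' A) with hf
  set g : ℝ → ℝ≥0∞ := fun x ↦ volume (Prod.mk x ⁻¹' B) with hg
  set h : ℝ → ℝ≥0∞ := fun x ↦ volume (Prod.mk x ⁻¹' (A + B)) with hh
  have hfm : Measurable f := measurable_measure_prodMk_left hA.measurableSet
  have hgm : Measurable g := measurable_measure_prodMk_left hB.measurableSet
  have hABo : IsOpen (A + B) := hA.add_right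
  have hABb : Bornology.IsBounded (A + B) := hAb.add hBb
  have hhm : Measurable h := measurable_measure_prodMk_left hABo.measurableSet
  have hbdd : ∀ {C : Set (ℝ × ℝ)}, Bornology.IsBounded C →
      ⨆ x, volume (Prod.mk x ⁻¹' C) < ∞ := by
    intro C hC
    obtain ⟨R, hR⟩ := hC.subset_closedBall 0
    refine lt_of_le_of_lt (iSup_le fun x ↦ measure_mono (t := closedBall 0 R) ?_)
      measure_closedBall_lt_top
    intro y hy
    have := hR hy
    rw [mem_closedBall_zero_iff] at this ⊢
    exact (norm_snd_le _).trans this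
  have hpos : ∀ {C : Set (ℝ × ℝ)}, IsOpen C → C.Nonempty →
      0 < ⨆ x, volume (Prod.mk x ⁻¹' C) := by
    rintro C hC ⟨⟨x, y⟩, hxy⟩
    refine lt_of_lt_of_le ?_ (le_iSup _ x)
    exact (hC.preimage (by fun_prop)).measure_pos _ ⟨y, hxy⟩
  obtain ⟨M, hM, hfM⟩ : ∃ M : ℝ, 0 < M ∧ ⨆ x, f x = ENNReal.ofReal M :=
    ⟨(⨆ x, f x).toReal, ENNReal.toReal_pos (hpos hA hA₀).ne' (hbdd hAb).ne,
      (ENNReal.ofReal_toReal (hbdd hAb).ne).symm⟩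
  obtain ⟨m, hm, hgm'⟩ : ∃ M : ℝ, 0 < M ∧ ⨆ x, g x = ENNReal.ofReal M :=
    ⟨(⨆ x, g x).toReal, ENNReal.toReal_pos (hpos hB hB₀).ne' (hbdd hBb).ne,
      (ENNReal.ofReal_toReal (hbdd hBb).ne).symm⟩
  have hvA : volume A = ∫⁻ x, f x := Measure.prod_apply hA.measurableSet
  have hvB : volume B = ∫⁻ x, g x := Measure.prod_apply hB.measurableSet
  have hvAB : volume (A + B) = ∫⁻ x, h x := Measure.prod_apply hABo.measurableSet
  have hfg : ∀ x y, f x ≠ 0 → g y ≠ 0 → f x + g y ≤ h (x + y) := by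
    intro x y hx hy
    refine (Real.volume_add_volume_le_volume_add (hA.preimage (by fun_prop)).measurableSet
      (hB.preimage (by fun_prop)).measurableSet (nonempty_of_measure_ne_zero hx)
      (nonempty_of_measure_ne_zero hy)).trans (measure_mono ?_)
    rintro _ ⟨u, hu, v, hv, rfl⟩
    exact ⟨(x, u), hu, (y, v), hv, rfl⟩
  have hsub : ∀ t ∈ Ioo (0 : ℝ) 1, volume {x | ENNReal.ofReal (t * M) < f x} +
      volume {x | ENNReal.ofReal (t * m) < g x} ≤
        volume {x | ENNReal.ofReal (t * (M + m)) < h x} := by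
    intro t ht
    have hlt : ∀ {M : ℝ}, 0 < M → ENNReal.ofReal (t * M) < ENNReal.ofReal M := fun hM ↦
      (ENNReal.ofReal_lt_ofReal_iff hM).2 (by nlinarith [ht.2])
    refine (Real.volume_add_volume_le_volume_add (measurableSet_lt measurable_const hfm)
      (measurableSet_lt measurable_const hgm) ?_
      ?_).trans (measure_mono ?_)
    · exact lt_iSup_iff.1 (hfM ▸ hlt hM)
    · exact lt_iSup_iff.1 (hgm' ▸ hlt hm)
    rintro _ ⟨x, hx, y, hy, rfl⟩
    refine lt_of_lt_of_le ?_ (hfg x y (ne_bot_of_gt hx) (ne_bot_of_gt hy))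
    rw [mul_add, ENNReal.ofReal_add (mul_pos ht.1 hM).le (mul_pos ht.1 hm).le]
    exact ENNReal.add_lt_add hx hy
  have hmono : Antitone fun t : ℝ ↦ volume {x | ENNReal.ofReal (t * M) < f x} := by
    refine fun s t hst ↦ measure_mono fun x hx ↦ ?_
    rw [mem_ofPred_eq] at hx ⊢
    refine lt_of_le_of_lt ?_ hx
    gcongr
  have hAe := lintegral_eq_mul_lintegral_Ioo_meas hfm hM (fun x ↦ hfM ▸ le_iSup f x)
  have hBe := lintegral_eq_mul_lintegral_Ioo_meas hgm hm (fun x ↦ hgm' ▸ le_iSup g x)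
  have hABle := (mul_le_mul_right (setLIntegral_mono' measurableSet_Ioo hsub) _).trans
    (mul_lintegral_Ioo_meas_le hhm (add_pos hM hm))
  rw [lintegral_add_left hmono.measurable] at hABle
  have hfin : ∀ {C : Set (ℝ × ℝ)}, Bornology.IsBounded C → volume C ≠ ∞ :=
    fun hC ↦ hC.measure_lt_top.ne
  rw [← hvA] at hAe
  rw [← hvB] at hBe
  rw [← hvAB] at hABle
  set IA := ∫⁻ t in Ioo (0 : ℝ) 1, volume {x | ENNReal.ofReal (t * M) < f x}
  set IB := ∫⁻ t in Ioo (0 : ℝ) 1, volume {x | ENNReal.ofReal (t * m) < g x}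
  have hIA : IA ≠ ∞ := fun h ↦ hfin hAb (by rw [hAe, h, ENNReal.mul_top (by simpa using hM)])
  have hIB : IB ≠ ∞ := fun h ↦ hfin hBb (by rw [hBe, h, ENNReal.mul_top (by simpa using hm)])
  have hAr : volume.real A = M * IA.toReal := by
    rw [measureReal_def, hAe, ENNReal.toReal_mul, ENNReal.toReal_ofReal hM.le]
  have hBr : volume.real B = m * IB.toReal := by
    rw [measureReal_def, hBe, ENNReal.toReal_mul, ENNReal.toReal_ofReal hm.le]
  have hABr : (M + m) * (IA.toReal + IB.toReal) ≤ volume.real (A + B) := by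
    have := ENNReal.toReal_mono (hfin hABb) hABle
    rwa [ENNReal.toReal_mul, ENNReal.toReal_ofReal (by positivity),
      ENNReal.toReal_add hIA hIB] at this
  refine le_trans ?_ hABr
  rw [hAr, hBr]
  have ha : 0 ≤ IA.toReal := ENNReal.toReal_nonneg
  have hb : 0 ≤ IB.toReal := ENNReal.toReal_nonneg
  have hs : 2 * √(M * IA.toReal * (m * IB.toReal)) ≤ m * IA.toReal + M * IB.toReal := by
    have : √(M * IA.toReal * (m * IB.toReal)) = √(m * IA.toReal) * √(M * IB.toReal) := by
      rw [← Real.sqrt_mul (by positivity)]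
      ring_nf
    rw [this]
    nlinarith [sq_nonneg (√(m * IA.toReal) - √(M * IB.toReal)),
      Real.sq_sqrt (show 0 ≤ m * IA.toReal by positivity),
      Real.sq_sqrt (show 0 ≤ M * IB.toReal by positivity)]
  linarith

theorem Complex.volume_add_two_mul_sqrt_le_volume_thickening {E : Set ℂ} (hE : IsOpen E)
    (hEb : Bornology.IsBounded E) {δ : ℝ} (hδ : 0 < δ) :
    volume.real E + 2 * √Real.pi * δ * √(volume.real E) ≤ volume.real (thickening δ E) := by
  rcases E.eq_empty_or_nonempty with rfl | hE₀
  · simp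
  set e := Complex.equivRealProdCLM
  have hopen : ∀ {C : Set ℂ}, IsOpen C → IsOpen (e '' C) := fun hC ↦ e.toHomeomorph.isOpenMap _ hC
  have hvol : ∀ {C : Set ℂ}, IsOpen C → volume.real (e '' C) = volume.real C := fun {C} hC ↦ by
    rw [measureReal_def, measureReal_def,
      ← Complex.volume_preserving_equiv_real_prod.measure_preimage
        (hopen hC).measurableSet.nullMeasurableSet]
    congr 2
    exact e.injective.preimage_image C
  have hbd : ∀ {C : Set ℂ}, Bornology.IsBounded C → Bornology.IsBounded (e '' C) :=
    fun hC ↦ e.lipschitz.isBounded_image hC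
  have := Real.volume_prod_add_le (hopen hE) (hopen (isOpen_ball (x := 0) (ε := δ)))
    (hE₀.image e) ((nonempty_ball.2 hδ).image e) (hbd hEb) (hbd isBounded_ball)
  have himg : (e : ℂ → ℝ × ℝ) '' E + e '' ball 0 δ = e '' (thickening δ E) := by
    rw [← image_add, add_ball_zero]
  rw [himg, hvol hE, hvol isOpen_ball,
    hvol isOpen_thickening] at this
  have hb : volume.real (ball (0 : ℂ) δ) = Real.pi * δ ^ 2 := by
    rw [measureReal_def, Complex.volume_ball]
    simp [ENNReal.toReal_ofReal hδ.le, mul_comm]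
  rw [hb, Real.sqrt_mul measureReal_nonneg, Real.sqrt_mul Real.pi_pos.le,
    Real.sqrt_sq hδ.le] at this
  have : 0 ≤ Real.pi * δ ^ 2 := by positivity
  linarith

end Pointwise

/-- A Sobolev-type inequality with sharp constant: `w` plays the role of an upper gradient of a
potential `u` separating `K` from the complement of a bounded set `V`. -/
theorem two_mul_sqrt_pi_le_lintegral_of_potential {u w : ℂ → ℝ≥0∞} {W : ℝ≥0∞} {K V : Set ℂ}
    (hw : Measurable w) (hW : W ≠ ∞) (hwW : ∀ x, w x ≤ W) (hV : Bornology.IsBounded V)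
    (hwc : ∀ κ : ℝ, 0 < κ → ∃ δ : ℝ, 0 < δ ∧ ∀ x x', dist x x' < δ → w x' ≤ w x + .ofReal κ)
    (hu : ∀ x y c, (∀ z ∈ segment ℝ x y, w z ≤ c) → u y ≤ u x + edist x y * c)
    (huK : ∀ x ∈ K, u x = 0) (huV : ∀ x ∉ V, 1 ≤ u x) :
    ENNReal.ofReal (2 * √Real.pi * √(volume.real K)) ≤ ∫⁻ x, w x := by
  have hucont : Continuous u := by
    refine continuous_of_le_add_edist W hW fun x y ↦ ?_
    rw [mul_comm, edist_comm]
    exact hu y x W fun z _ ↦ hwW z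
  have hV' : volume (thickening 1 V) ≠ ∞ := hV.thickening.measure_lt_top.ne
  suffices H : ∀ κ : ℝ, 0 < κ → ENNReal.ofReal (2 * √Real.pi * √(volume.real K)) ≤
      (∫⁻ x, w x) + ENNReal.ofReal κ * volume (thickening 1 V) by
    have hlim : Filter.Tendsto (fun κ : ℝ ↦ (∫⁻ x, w x) + ENNReal.ofReal κ *
        volume (thickening 1 V)) (nhdsWithin 0 (Ioi 0)) (nhds ((∫⁻ x, w x) + 0)) := by
      refine tendsto_const_nhds.add ?_
      rw [← zero_mul (volume (thickening 1 V))]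
      refine ENNReal.Tendsto.mul_const ?_ (.inr hV')
      refine Filter.Tendsto.mono_left ?_ nhdsWithin_le_nhds
      simpa using ENNReal.continuous_ofReal.tendsto 0
    rw [add_zero] at hlim
    exact ge_of_tendsto hlim (by filter_upwards [self_mem_nhdsWithin] with κ hκ using H κ hκ)
  intro κ hκ
  obtain ⟨δ₀, hδ₀, hwδ⟩ := hwc κ hκ
  set δ := min δ₀ 1
  have hδ : 0 < δ := by positivity
  set E : ℝ → Set ℂ := fun s ↦ {x | u x < ENNReal.ofReal s} with hE
  have hEo : ∀ s, IsOpen (E s) := fun s ↦ isOpen_lt hucont continuous_const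
  have hEV : ∀ s ∈ Ioo (0 : ℝ) 1, E s ⊆ V := fun s hs x hx ↦ by
    by_contra hxV
    refine (huV x hxV).not_gt (lt_of_lt_of_le hx ?_)
    simpa using hs.2.le
  have hKE : ∀ s ∈ Ioo (0 : ℝ) 1, K ⊆ E s := fun s hs x hx ↦ by
    simp [hE, huK x hx, hs.1]
  set P : Set (ℝ × ℂ) := {p | p.1 ∈ Ioo (0 : ℝ) 1 ∧ p.2 ∈ thickening δ (E p.1) \ E p.1} with hP
  have hPm : MeasurableSet P := by
    have h1 : IsOpen {p : ℝ × ℂ | p.2 ∈ E p.1} :=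
      isOpen_lt (hucont.comp continuous_snd) (ENNReal.continuous_ofReal.comp continuous_fst)
    have h2 : IsOpen {p : ℝ × ℂ | p.2 ∈ thickening δ (E p.1)} := by
      have : {p : ℝ × ℂ | p.2 ∈ thickening δ (E p.1)} =
          ⋃ y ∈ ball (0 : ℂ) δ, (fun p : ℝ × ℂ ↦ (p.1, p.2 + y)) ⁻¹' {p | p.2 ∈ E p.1} := by
        ext ⟨s, x⟩
        simp only [mem_ofPred_eq, mem_thickening_iff, mem_iUnion, mem_preimage, exists_prop]
        constructor
        · rintro ⟨z, hz, hd⟩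
          exact ⟨z - x, by rwa [mem_ball_zero_iff, ← dist_eq_norm, dist_comm], by simpa using hz⟩
        · rintro ⟨y, hy, hz⟩
          exact ⟨x + y, hz, by simpa using hy⟩
      rw [this]
      exact isOpen_biUnion fun y _ ↦ h1.preimage (by fun_prop)
    exact (measurableSet_Ioo.preimage measurable_fst).inter
      (h2.measurableSet.diff h1.measurableSet)
  have hlower : ENNReal.ofReal (2 * √Real.pi * δ * √(volume.real K)) ≤
      (volume.prod volume) P := by
    rw [Measure.prod_apply hPm]
    calc _ = ∫⁻ _ in Ioo (0 : ℝ) 1, ENNReal.ofReal (2 * √Real.pi * δ * √(volume.real K)) := by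
          simp
      _ ≤ ∫⁻ s in Ioo (0 : ℝ) 1, volume (Prod.mk s ⁻¹' P) := by
          refine setLIntegral_mono' measurableSet_Ioo fun s hs ↦ ?_
          have hEb := hV.subset (hEV s hs)
          have h1 := Complex.volume_add_two_mul_sqrt_le_volume_thickening (hEo s) hEb hδ
          have h2 : volume.real K ≤ volume.real (E s) :=
            measureReal_mono (hKE s hs) hEb.measure_lt_top.ne
          have h3 : Prod.mk s ⁻¹' P = thickening δ (E s) \ E s := by
            ext x
            simp only [hP, mem_preimage, mem_ofPred_eq, and_iff_right hs]
          rw [h3]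
          refine ENNReal.ofReal_le_of_le_toReal ?_
          rw [← measureReal_def, measureReal_sdiff (self_subset_thickening hδ _)
            (hEo s).measurableSet hEb.thickening.measure_lt_top.ne]
          have h4 := mul_le_mul_of_nonneg_left (Real.sqrt_le_sqrt h2)
            (show 0 ≤ 2 * √Real.pi * δ by positivity)
          linarith
      _ ≤ _ := setLIntegral_le_lintegral _ _
  have hupper : (volume.prod volume) P ≤
      ENNReal.ofReal δ * ((∫⁻ x, w x) + ENNReal.ofReal κ * volume (thickening 1 V)) := by
    rw [Measure.prod_apply_symm hPm]
    calc ∫⁻ x, volume ((fun s ↦ (s, x)) ⁻¹' P)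
        ≤ ∫⁻ x, ENNReal.ofReal δ * (w x + (thickening 1 V).indicator (fun _ ↦ .ofReal κ) x) := by
          refine lintegral_mono fun x ↦ ?_
          by_cases hx : x ∈ thickening 1 V
          · rw [indicator_of_mem hx]
            have hDtop : w x + ENNReal.ofReal κ ≠ ∞ :=
              ENNReal.add_ne_top.2 ⟨((hwW x).trans_lt hW.lt_top).ne, ENNReal.ofReal_ne_top⟩
            set D := (w x + ENNReal.ofReal κ).toReal with hD
            have hD' : ENNReal.ofReal D = w x + ENNReal.ofReal κ := ENNReal.ofReal_toReal hDtop
            rw [← hD', ← ENNReal.ofReal_mul hδ.le]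
            refine (measure_mono (t := Icc ((u x).toReal - δ * D) (u x).toReal) ?_).trans
              (by simp)
            rintro s ⟨hs, hxs, hxs'⟩
            obtain ⟨z, hz, hd⟩ := mem_thickening_iff.1 hxs
            have hux : u x ≤ u z + edist z x * (w x + .ofReal κ) := by
              refine hu z x _ fun y hy ↦ hwδ x y ?_
              have := segment_subset_closedBall_right z x hy
              rw [mem_closedBall, dist_comm, dist_comm z x] at this
              exact this.trans_lt (hd.trans_le (min_le_left _ _))
            have hed : edist z x ≤ ENNReal.ofReal δ := by
              rw [edist_dist, dist_comm]
              exact ENNReal.ofReal_le_ofReal hd.le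
            have hux' : u x ≤ ENNReal.ofReal (s + δ * D) := by
              rw [ENNReal.ofReal_add hs.1.le (by positivity), ENNReal.ofReal_mul hδ.le, hD']
              refine hux.trans (add_le_add (le_of_lt hz) ?_)
              gcongr
            constructor
            · have := ENNReal.toReal_le_of_le_ofReal (by have := hs.1; positivity) hux'
              linarith
            · refine (ENNReal.ofReal_le_iff_le_toReal (ne_top_of_le_ne_top
                ENNReal.ofReal_ne_top hux')).1 (not_lt.1 hxs')
          · refine (measure_mono_null (t := ∅) (subset_empty_iff.2 ?_) measure_empty).trans_le zero_le
            refine eq_empty_of_forall_notMem ?_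
            rintro s ⟨hs, hxs, -⟩
            exact hx (thickening_subset_of_subset _ (hEV s hs)
              (thickening_mono (min_le_right _ _) _ hxs))
      _ = _ := by
          rw [lintegral_const_mul _ (by
            exact hw.add (measurable_const.indicator isOpen_thickening.measurableSet)),
            lintegral_add_left hw, lintegral_indicator_const isOpen_thickening.measurableSet]
  have hδne : ENNReal.ofReal δ ≠ 0 := by simpa using hδ
  rw [← ENNReal.mul_le_mul_iff_right hδne ENNReal.ofReal_ne_top, ← ENNReal.ofReal_mul hδ.le]
  refine le_trans (le_of_eq ?_) (hlower.trans hupper)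
  ring_nf

/-- The distance from the set `K` weighted by `w`, computed along `1`-Lipschitz paths. -/
noncomputable def weightedDist (w : ℂ → ℝ≥0∞) (K : Set ℂ) (x : ℂ) : ℝ≥0∞ :=
  ⨅ (η : ℝ → ℂ) (L : ℝ) (_ : LipschitzWith 1 η ∧ 0 ≤ L ∧ η 0 ∈ K ∧ η L = x),
    ∫⁻ t in Ioc 0 L, w (η t)

theorem weightedDist_eq_zero {w : ℂ → ℝ≥0∞} {K : Set ℂ} {x : ℂ} (hx : x ∈ K) :
    weightedDist w K x = 0 := by
  refine le_antisymm ?_ zero_le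
  refine (iInf₂_le_of_le (fun _ ↦ x) 0 (iInf_le _ ?_)).trans (by simp)
  exact ⟨LipschitzWith.const' x, le_rfl, hx, rfl⟩

theorem LipschitzWith.extend_ray {η : ℝ → ℂ} (hη : LipschitzWith 1 η) (L : ℝ) {e : ℂ}
    (he : ‖e‖ ≤ 1) : LipschitzWith 1 fun t ↦ η (min t L) + (max (t - L) 0) • e := by
  refine LipschitzWith.of_dist_le_mul fun s t ↦ ?_
  rw [NNReal.coe_one, one_mul]
  wlog hst : s ≤ t generalizing s t
  · rw [dist_comm, dist_comm s]
    exact this t s (le_of_not_ge hst)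
  have h1 := hη.dist_le_mul (min s L) (min t L)
  have h2 : dist ((max (s - L) 0) • e) ((max (t - L) 0) • e) ≤
      |max (s - L) 0 - max (t - L) 0| := by
    rw [dist_eq_norm, ← sub_smul, norm_smul, Real.norm_eq_abs]
    exact mul_le_of_le_one_right (abs_nonneg _) he
  refine (dist_add_add_le _ _ _ _).trans ((add_le_add h1 h2).trans ?_)
  rw [NNReal.coe_one, one_mul, Real.dist_eq, Real.dist_eq, abs_of_nonpos (a := s - t) (by linarith)]
  rcases le_total s L with h | h <;> rcases le_total t L with h' | h' <;>
    simp only [min_eq_left, min_eq_right, max_eq_left, max_eq_right, sub_nonneg, sub_nonpos, h, h',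
      sub_self, abs_zero, zero_sub, abs_neg, add_zero, zero_add] <;>
    grind

theorem weightedDist_le_add (w : ℂ → ℝ≥0∞) (K : Set ℂ) (x y : ℂ) (c : ℝ≥0∞)
    (hc : ∀ z ∈ segment ℝ x y, w z ≤ c) :
    weightedDist w K y ≤ weightedDist w K x + edist x y * c := by
  rcases eq_or_ne x y with rfl | hxy
  · exact le_self_add
  simp only [weightedDist, ENNReal.iInf_add]
  refine le_iInf fun η ↦ le_iInf fun L ↦ le_iInf fun ⟨hη, hL, h0, hx⟩ ↦ ?_
  set d := dist x y with hd
  have hdpos : 0 < d := dist_pos.2 hxy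
  set e : ℂ := d⁻¹ • (y - x) with he
  have hen : ‖e‖ ≤ 1 := by
    rw [he, norm_smul, ← dist_eq_norm, dist_comm, norm_inv, Real.norm_of_nonneg hdpos.le,
      inv_mul_cancel₀ hdpos.ne']
  have hlo : ∀ t ≤ L, η (min t L) + (max (t - L) 0) • e = η t := fun t ht ↦ by
    simp [ht]
  have hhi : ∀ t ≥ L, η (min t L) + (max (t - L) 0) • e = x + (t - L) • e := fun t ht ↦ by
    simp [ht, hx]
  refine (iInf₂_le_of_le _ (L + d) (iInf_le_of_le ⟨hη.extend_ray L hen, by positivity, ?_, ?_⟩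
    le_rfl)).trans ?_
  on_goal 2 => rwa [hlo 0 hL]
  on_goal 2 => rw [hhi _ (by linarith), he, add_sub_cancel_left, smul_inv_smul₀ hdpos.ne', add_sub_cancel]
  rw [← Ioc_union_Ioc_eq_Ioc hL (by linarith : L ≤ L + d)]
  refine (lintegral_union_le _ _ _).trans (add_le_add (le_of_eq ?_) ?_)
  · exact setLIntegral_congr_fun measurableSet_Ioc fun t ht ↦ by rw [hlo t ht.2]
  · refine (setLIntegral_mono' (g := fun _ ↦ c) measurableSet_Ioc fun t ht ↦ ?_).trans ?_
    · rw [hhi t ht.1.le]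
      refine hc _ ?_
      rw [segment_eq_image']
      refine ⟨(t - L) / d, ⟨div_nonneg (by linarith [ht.1]) hdpos.le,
        (div_le_one hdpos).2 (by linarith [ht.2])⟩, ?_⟩
      simp only [he, smul_smul, div_eq_mul_inv]
    · rw [setLIntegral_const, Real.volume_Ioc, add_sub_cancel_left, edist_dist, mul_comm]

/-- Sharp lower bound for the `1`-modulus of the paths joining `K` to the complement of `V`, for
uniformly continuous densities. -/
theorem two_mul_sqrt_pi_le_lintegral_of_path {w : ℂ → ℝ≥0∞} {W : ℝ≥0∞} {K V : Set ℂ}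
    (hw : Measurable w) (hW : W ≠ ∞) (hwW : ∀ x, w x ≤ W) (hV : Bornology.IsBounded V)
    (hwc : ∀ κ : ℝ, 0 < κ → ∃ δ : ℝ, 0 < δ ∧ ∀ x x', dist x x' < δ → w x' ≤ w x + .ofReal κ)
    (h : ∀ (η : ℝ → ℂ) (L : ℝ), LipschitzWith 1 η → 0 ≤ L → η 0 ∈ K → η L ∉ V →
      1 ≤ ∫⁻ t in Ioc 0 L, w (η t)) :
    ENNReal.ofReal (2 * √Real.pi * √(volume.real K)) ≤ ∫⁻ x, w x := by
  refine two_mul_sqrt_pi_le_lintegral_of_potential hw hW hwW hV hwc (weightedDist_le_add w K)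
    (fun x hx ↦ weightedDist_eq_zero hx) fun x hx ↦ ?_
  exact le_iInf fun η ↦ le_iInf fun L ↦ le_iInf fun ⟨hη, hL, h0, hxL⟩ ↦
    h η L hη hL h0 (hxL ▸ hx)

/-- Sharp lower bound for the `1`-modulus of the paths joining `K'` to the complement of `U`. -/
theorem two_mul_sqrt_pi_le_lintegral {ρ : ℂ → ℝ≥0∞} {K K' U : Set ℂ} {ε : ℝ} (hε : 0 < ε)
    (hρ : Measurable ρ) (hU : Bornology.IsBounded U) (hK : thickening ε K ⊆ K')
    (h : ∀ (η : ℝ → ℂ) (L : ℝ), LipschitzWith 1 η → 0 ≤ L → η 0 ∈ K' → η L ∉ U →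
      1 ≤ ∫⁻ t in Ioc 0 L, ρ (η t)) :
    ENNReal.ofReal (2 * √Real.pi * √(volume.real K)) ≤ ∫⁻ x, ρ x := by
  rcases eq_or_ne (∫⁻ x, ρ x) ∞ with htop | htop
  · simp [htop]
  let b : ContDiffBump (0 : ℂ) := ⟨ε / 2, ε, by positivity, by linarith⟩
  set φ : ℂ → ℝ := b.normed volume with hφ
  have hφc : Continuous φ := b.continuous_normed
  have hφ0 : ∀ x, 0 ≤ φ x := b.nonneg_normed
  have hφs : HasCompactSupport φ := b.hasCompactSupport_normed
  have hφu : UniformContinuous φ := hφs.uniformContinuous_of_continuous hφc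
  have hφsupp : ∀ x, φ x ≠ 0 → ‖x‖ < ε := fun x hx ↦ by
    have : x ∈ Function.support φ := hx
    rw [hφ, b.support_normed_eq] at this
    simpa using this
  have hφint : ∫⁻ x, ENNReal.ofReal (φ x) = 1 := by
    rw [← ofReal_integral_eq_lintegral_ofReal (b.integrable_normed) (ae_of_all _ hφ0),
      b.integral_normed, ENNReal.ofReal_one]
  obtain ⟨C, hC⟩ := hφc.bounded_above_of_compact_support hφs
  set w : ℂ → ℝ≥0∞ := fun x ↦ ∫⁻ y, ρ y * ENNReal.ofReal (φ (x - y)) with hw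
  have hw' : ∀ x, w x = ∫⁻ y, ρ (x - y) * ENNReal.ofReal (φ y) := fun x ↦ by
    rw [hw, ← lintegral_sub_left_eq_self _ x]
    simp
  have hwm : Measurable w := by
    refine Measurable.lintegral_prod_right' (ν := volume)
      (f := fun p : ℂ × ℂ ↦ ρ p.2 * ENNReal.ofReal (φ (p.1 - p.2))) ?_
    fun_prop
  have hwint : ∫⁻ x, w x = ∫⁻ x, ρ x := by
    rw [hw, lintegral_lintegral_swap (by fun_prop)]
    refine lintegral_congr fun y ↦ ?_
    rw [lintegral_const_mul _ (by fun_prop),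
      lintegral_sub_right_eq_self (fun x ↦ ENNReal.ofReal (φ x)) y, hφint, mul_one]
  rw [← hwint]
  refine two_mul_sqrt_pi_le_lintegral_of_path (V := thickening ε U) (W := (∫⁻ x, ρ x) * .ofReal C)
    hwm (ENNReal.mul_ne_top htop ENNReal.ofReal_ne_top) ?_ hU.thickening ?_ ?_
  · intro x
    rw [← lintegral_mul_const _ hρ]
    refine lintegral_mono fun y ↦ ?_
    gcongr
    exact (le_abs_self _).trans (hC _)
  · intro κ hκ
    set I := (∫⁻ x, ρ x).toReal
    have hI : 0 ≤ I := ENNReal.toReal_nonneg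
    obtain ⟨δ, hδ, hδ'⟩ := Metric.uniformContinuous_iff.1 hφu (κ / (I + 1)) (by positivity)
    refine ⟨δ, hδ, fun x x' hxx' ↦ ?_⟩
    calc w x' ≤ ∫⁻ y, (ρ y * ENNReal.ofReal (φ (x - y)) + ρ y * ENNReal.ofReal (κ / (I + 1))) := by
          refine lintegral_mono fun y ↦ ?_
          rw [← mul_add, ← ENNReal.ofReal_add (hφ0 _) (by positivity)]
          gcongr
          have := hδ' (a := x' - y) (b := x - y) (by rwa [dist_sub_right, dist_comm])
          rw [Real.dist_eq] at this
          linarith [le_abs_self (φ (x' - y) - φ (x - y))]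
      _ = w x + ENNReal.ofReal (I * (κ / (I + 1))) := by
          rw [lintegral_add_left (by fun_prop), lintegral_mul_const _ hρ, ENNReal.ofReal_mul hI,
            ENNReal.ofReal_toReal htop]
      _ ≤ _ := by
          gcongr
          rw [mul_div_assoc', div_le_iff₀ (by positivity)]
          nlinarith
  · intro η L hη hL h0 hηL
    have hηc := hη.continuous
    calc 1 = ∫⁻ y, 1 * ENNReal.ofReal (φ y) := by simp [hφint]
      _ ≤ ∫⁻ y, (∫⁻ t in Ioc 0 L, ρ (η t - y)) * ENNReal.ofReal (φ y) := by
          refine lintegral_mono fun y ↦ ?_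
          rcases eq_or_ne (φ y) 0 with hy | hy
          · simp [hy]
          have hy' := hφsupp y hy
          gcongr
          refine h (fun t ↦ η t - y) L ?_ hL (hK ?_) fun hmem ↦ hηL ?_
          · simpa using hη.sub (LipschitzWith.const y)
          · exact mem_thickening_iff.2 ⟨η 0, h0, by simpa using hy'⟩
          · exact mem_thickening_iff.2 ⟨_, hmem, by simpa using hy'⟩
      _ = ∫⁻ y, ∫⁻ t in Ioc 0 L, ρ (η t - y) * ENNReal.ofReal (φ y) := by
          refine lintegral_congr fun y ↦ ?_
          rw [lintegral_mul_const _ (by fun_prop)]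
      _ = ∫⁻ t in Ioc 0 L, w (η t) := by
          rw [lintegral_lintegral_swap (by fun_prop)]
          simp_rw [hw']

theorem exists_crossing {η : ℝ → ℂ} (hη : Continuous η) {L : ℝ} (hL : 0 ≤ L) {K U : Set ℂ}
    (hK : IsClosed K) (hU : IsOpen U) (hKU : K ⊆ U) (h0 : η 0 ∈ K) (h1 : η L ∉ U) :
    ∃ σ τ, 0 ≤ σ ∧ σ < τ ∧ τ ≤ L ∧ η σ ∈ K ∧ η τ ∉ U ∧ (∀ t ∈ Ico σ τ, η t ∈ U) ∧
      ∀ t ∈ Ioo σ τ, η t ∉ K := by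
  obtain ⟨τ, ⟨⟨hτ0, hτL⟩, hτU⟩, hτ⟩ := (isCompact_Icc.inter_right
    (hU.isClosed_compl.preimage hη)).exists_isLeast ⟨L, right_mem_Icc.2 hL, h1⟩
  obtain ⟨σ, ⟨⟨hσ0, hστ⟩, hσK⟩, hσ⟩ := ((isCompact_Icc (a := 0) (b := τ)).inter_right
    (hK.preimage hη)).exists_isGreatest ⟨0, left_mem_Icc.2 hτ0, h0⟩
  refine ⟨σ, τ, hσ0, lt_of_le_of_ne hστ ?_, hτL, hσK, hτU, fun t ht ↦ ?_, fun t ht htK ↦ ?_⟩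
  · rintro rfl
    exact hτU (hKU hσK)
  · by_contra htU
    exact (hτ ⟨⟨hσ0.trans ht.1, ht.2.le.trans hτL⟩, htU⟩).not_gt ht.2
  · exact (hσ ⟨⟨hσ0.trans ht.1.le, ht.2.le⟩, htK⟩).not_gt ht.1

/-- The curves in the unit disc joining the closed disc of radius `a` to the complement of the
open disc of radius `b`. -/
def ringCurves (a b : ℝ) : Set (ℝ → ℂ) :=
  {γ | ContinuousOn γ (Icc 0 1) ∧ (∀ t ∈ Icc (0 : ℝ) 1, γ t ∈ ball (0 : ℂ) 1) ∧
    γ 0 ∈ closedBall (0 : ℂ) a ∧ γ 1 ∉ ball (0 : ℂ) b}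

theorem IsHomeoOn.continuousOn_invFunOn {f : ℂ → ℂ} {D : Set ℂ} (hf : IsHomeoOn f D)
    (hD : IsOpen D) : ContinuousOn (Function.invFunOn f D) (f '' D) := by
  rw [continuousOn_open_iff (hf.2.2 D Subset.rfl hD)]
  intro t ht
  convert hf.2.2 (D ∩ t) inter_subset_left (hD.inter ht) using 1
  ext w
  constructor
  · rintro ⟨⟨z, hz, rfl⟩, hw⟩
    rw [mem_preimage, hf.2.1.leftInvOn_invFunOn hz] at hw
    exact ⟨z, ⟨hz, hw⟩, rfl⟩
  · rintro ⟨z, ⟨hz, hzt⟩, rfl⟩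
    refine ⟨mem_image_of_mem _ hz, ?_⟩
    rwa [mem_preimage, hf.2.1.leftInvOn_invFunOn hz]

theorem lintegral_Icc_mul_deriv_le {η γ : ℝ → ℂ} {ρ : ℂ → ℝ≥0∞} {σ τ : ℝ} (hστ : σ < τ)
    (hγ : LipschitzWith (τ - σ).toNNReal γ)
    (hγη : ∀ t ∈ Icc (0 : ℝ) 1, γ t = η (σ + (τ - σ) * t)) :
    ∫⁻ t in Icc (0 : ℝ) 1, ρ (γ t) * (‖deriv γ t‖₊ : ℝ≥0∞) ≤ ∫⁻ t in Ioo σ τ, ρ (η t) := by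
  have himg : (fun t ↦ σ + (τ - σ) * t) '' Ioo 0 1 = Ioo σ τ := by
    convert! image_affine_Ioo (sub_pos.2 hστ) σ 0 1 using 2 <;> ring
  rw [← himg, lintegral_image_eq_lintegral_abs_deriv_mul (f' := fun _ ↦ τ - σ) measurableSet_Ioo,
    setLIntegral_congr Ioo_ae_eq_Icc.symm]
  · refine setLIntegral_mono' measurableSet_Ioo fun t ht ↦ ?_
    rw [hγη t (Ioo_subset_Icc_self ht), mul_comm, abs_of_pos (sub_pos.2 hστ)]
    gcongr
    rw [ENNReal.ofReal, ENNReal.coe_le_coe]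
    exact norm_deriv_le_of_lipschitz hγ
  · intro t _
    simpa using ((hasDerivAt_id t).const_mul (τ - σ)).const_add σ |>.hasDerivWithinAt
  · intro s _ t _ h
    have := sub_pos.2 hστ
    simpa [this.ne'] using h

theorem IsHomeoOn.one_le_lintegral_indicator {f : ℂ → ℂ} (hf : IsHomeoOn f (ball 0 1))
    {a b : ℝ} (hab : a < b) (hb : b < 1) {ρ : ℂ → ℝ≥0∞}
    (hρ : IsAdmissible ρ ((fun γ ↦ f ∘ γ) '' ringCurves a b)) {η : ℝ → ℂ} {L : ℝ}
    (hη : LipschitzWith 1 η) (hL : 0 ≤ L) (h0 : η 0 ∈ f '' closedBall 0 a)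
    (h1 : η L ∉ f '' ball 0 b) :
    1 ≤ ∫⁻ t in Ioc 0 L, (f '' (ball 0 b \ closedBall 0 a)).indicator ρ (η t) := by
  have hbD : closedBall (0 : ℂ) b ⊆ ball 0 1 := closedBall_subset_ball hb
  have hbD' : ball (0 : ℂ) b ⊆ ball 0 1 := ball_subset_ball hb.le
  have haD : closedBall (0 : ℂ) a ⊆ ball 0 1 := closedBall_subset_ball (hab.trans hb)
  have hcomp : ∀ {c : ℝ}, c < 1 → IsCompact (f '' closedBall 0 c) := fun hc ↦
    (isCompact_closedBall 0 _).image_of_continuousOn (hf.1.mono (closedBall_subset_ball hc))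
  have hU : IsOpen (f '' ball 0 b) := hf.2.2 _ hbD' isOpen_ball
  obtain ⟨σ, τ, hσ, hστ, hτ, hσK, hτU, hin, hout⟩ := exists_crossing hη.continuous hL
    (hcomp (hab.trans hb)).isClosed hU (image_mono (closedBall_subset_ball hab)) h0 h1
  have hIcc : ∀ t ∈ Icc σ τ, η t ∈ f '' closedBall 0 b := by
    intro t ht
    rw [← closure_Ico hστ.ne] at ht
    refine (hcomp hb).isClosed.closure_subset_iff.2 ?_
      (image_closure_subset_closure_image hη.continuous (mem_image_of_mem η ht))
    rintro _ ⟨s, hs, rfl⟩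
    exact image_mono ball_subset_closedBall (hin s hs)
  set g := Function.invFunOn f (ball 0 1) with hg
  set γ : ℝ → ℂ := fun t ↦ η (projIcc σ τ hστ.le (σ + (τ - σ) * t)) with hγ
  have hγc : ∀ t, γ t ∈ f '' closedBall 0 b := fun t ↦ hIcc _ (Subtype.prop _)
  have hγD : ∀ t, γ t ∈ f '' ball 0 1 := fun t ↦ image_mono hbD (hγc t)
  have hγη : ∀ t ∈ Icc (0 : ℝ) 1, γ t = η (σ + (τ - σ) * t) := fun t ht ↦ by
    have hmem : σ + (τ - σ) * t ∈ Icc σ τ := by constructor <;> nlinarith [ht.1, ht.2]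
    simp only [hγ, projIcc_of_mem hστ.le hmem]
  have hfg : f ∘ (g ∘ γ) = γ := funext fun t ↦ Function.invFunOn_eq (hγD t)
  have hγl : LipschitzWith (τ - σ).toNNReal γ := by
    refine LipschitzWith.of_dist_le_mul fun s t ↦ ?_
    refine (hη.dist_le_mul _ _).trans ?_
    rw [NNReal.coe_one, one_mul]
    refine ((LipschitzWith.projIcc hστ.le).dist_le_mul _ _).trans ?_
    rw [NNReal.coe_one, one_mul, Real.coe_toNNReal _ (sub_pos.2 hστ).le, Real.dist_eq, Real.dist_eq,
      ← abs_of_pos (sub_pos.2 hστ), ← abs_mul, abs_of_pos (sub_pos.2 hστ)]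
    exact le_of_eq (by ring_nf)
  have hmem : g ∘ γ ∈ ringCurves a b := by
    refine ⟨?_, fun t _ ↦ Function.invFunOn_mem (hγD t), ?_, fun h ↦ hτU ?_⟩
    · exact ((hf.continuousOn_invFunOn isOpen_ball).comp_continuous hγl.continuous hγD).continuousOn
    · obtain ⟨z, hz, hzσ⟩ := hσK
      have : γ 0 = f z := by rw [hγη 0 (by simp), hzσ]; simp
      rw [Function.comp, this, hg, hf.2.1.leftInvOn_invFunOn (haD hz)]
      exact hz
    · have : f (g (γ 1)) = η τ := (congrFun hfg 1).trans (by rw [hγη 1 (by simp)]; simp)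
      exact ⟨_, h, this⟩
  have hone := hρ.2 _ (mem_image_of_mem _ hmem)
  simp only [hfg] at hone
  rw [lineIntegral, if_pos ⟨_, hγl.lipschitzOnWith⟩] at hone
  calc 1 ≤ _ := hone
    _ ≤ ∫⁻ t in Ioo σ τ, ρ (η t) := lintegral_Icc_mul_deriv_le hστ hγl hγη
    _ = ∫⁻ t in Ioo σ τ, (f '' (ball 0 b \ closedBall 0 a)).indicator ρ (η t) := by
        refine setLIntegral_congr_fun measurableSet_Ioo fun t ht ↦ ?_
        obtain ⟨z, hz, hzt⟩ := hin t (Ioo_subset_Ico_self ht)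
        have hmem : η t ∈ f '' (ball 0 b \ closedBall 0 a) :=
          ⟨z, ⟨hz, fun hza ↦ hout t ht (hzt ▸ mem_image_of_mem f hza)⟩, hzt⟩
        exact (indicator_of_mem hmem _).symm
    _ ≤ _ := lintegral_mono_set
        (Ioo_subset_Ioc_self.trans (Ioc_subset_Ioc hσ hτ))

theorem IsHomeoOn.two_mul_sqrt_pi_le_lintegral {f : ℂ → ℂ} (hf : IsHomeoOn f (ball 0 1))
    {a b : ℝ} (hab : a < b) (hb : b < 1) {ρ : ℂ → ℝ≥0∞}
    (hρ : IsAdmissible ρ ((fun γ ↦ f ∘ γ) '' ringCurves a b)) :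
    ENNReal.ofReal (2 * √Real.pi * √(volume.real (f '' ball 0 a))) ≤
      ∫⁻ x, (f '' (ball 0 b \ closedBall 0 a)).indicator ρ x := by
  have hcomp : ∀ {c : ℝ}, c < 1 → IsCompact (f '' closedBall 0 c) := fun hc ↦
    (isCompact_closedBall 0 _).image_of_continuousOn (hf.1.mono (closedBall_subset_ball hc))
  have hR : IsOpen (f '' (ball 0 b \ closedBall 0 a)) :=
    hf.2.2 _ (sdiff_subset.trans (ball_subset_ball hb.le)) (isOpen_ball.sdiff isClosed_closedBall)
  have hUa : IsOpen (f '' ball 0 a) := hf.2.2 _ (ball_subset_ball (hab.trans hb).le) isOpen_ball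
  have key : ∀ c < a, ENNReal.ofReal (2 * √Real.pi * √(volume.real (f '' closedBall 0 c))) ≤
      ∫⁻ x, (f '' (ball 0 b \ closedBall 0 a)).indicator ρ x := by
    intro c hc
    obtain ⟨ε, hε, hεa⟩ := (hcomp (hc.trans (hab.trans hb))).exists_thickening_subset_open hUa
      (image_mono (closedBall_subset_ball hc))
    refine _root_.two_mul_sqrt_pi_le_lintegral hε (hρ.1.indicator hR.measurableSet)
      ((hcomp hb).isBounded.subset (image_mono ball_subset_closedBall))
      (hεa.trans (image_mono ball_subset_closedBall)) fun η L hη hL h0 h1 ↦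
      hf.one_le_lintegral_indicator hab hb hρ hη hL h0 h1
  obtain ⟨u, hu, hua, hlim⟩ := exists_seq_strictMono_tendsto a
  have hunion : ⋃ n, f '' closedBall 0 (u n) = f '' ball 0 a := by
    rw [← image_iUnion]
    congr 1
    ext z
    simp only [mem_iUnion, mem_closedBall, mem_ball]
    refine ⟨fun ⟨n, hn⟩ ↦ hn.trans_lt (hua n), fun hz ↦ ?_⟩
    exact ((hlim.eventually (eventually_gt_nhds hz)).exists).imp fun n hn ↦ hn.le
  have hmono : Monotone fun n ↦ f '' closedBall 0 (u n) := fun m n hmn ↦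
    image_mono (closedBall_subset_closedBall (hu.monotone hmn))
  have hfin : volume (f '' ball 0 a) ≠ ∞ :=
    ((hcomp (hab.trans hb)).isBounded.subset
      (image_mono ball_subset_closedBall)).measure_lt_top.ne
  have htend := tendsto_measure_iUnion_atTop (μ := volume) hmono
  rw [hunion] at htend
  have htend' := (ENNReal.tendsto_toReal hfin).comp htend
  refine le_of_tendsto (ENNReal.tendsto_ofReal ((htend'.sqrt).const_mul (2 * √Real.pi)))
    (Filter.Eventually.of_forall fun n ↦ key _ (hua n))

theorem rpow_lintegral_indicator_le {p : ℝ} (hp : 1 < p) {ρ : ℂ → ℝ≥0∞} (hρ : Measurable ρ)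
    {R : Set ℂ} (hR : MeasurableSet R) :
    (∫⁻ x, R.indicator ρ x) ^ p ≤ (∫⁻ x, ρ x ^ p) * volume R ^ (p - 1) := by
  have hpq := Real.HolderConjugate.conjExponent hp
  have h := ENNReal.lintegral_mul_le_Lp_mul_Lq volume hpq hρ.aemeasurable
    ((measurable_const (a := (1 : ℝ≥0∞))).indicator hR).aemeasurable
  have h1 : ∀ x, (ρ * (R.indicator fun _ ↦ (1 : ℝ≥0∞) : ℂ → ℝ≥0∞) : ℂ → ℝ≥0∞) x =
      R.indicator ρ x := fun x ↦ by
    by_cases hx : x ∈ R <;> simp [hx]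
  have h2 : ∀ x, (R.indicator (fun _ ↦ (1 : ℝ≥0∞)) x) ^ p.conjExponent =
      R.indicator (fun _ ↦ 1) x := fun x ↦ by
    by_cases hx : x ∈ R <;> simp [hx, hpq.symm.pos]
  simp_rw [h1, h2] at h
  rw [lintegral_indicator_const hR, one_mul] at h
  refine (ENNReal.rpow_le_rpow h hpq.nonneg).trans_eq ?_
  rw [ENNReal.mul_rpow_of_nonneg _ _ hpq.nonneg, ← ENNReal.rpow_mul, ← ENNReal.rpow_mul,
    one_div_mul_cancel hpq.ne_zero, ENNReal.rpow_one]
  congr 2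
  rw [Real.conjExponent, one_div_div, div_mul_cancel₀ _ hpq.ne_zero]

theorem IsHomeoOn.volume_real_add_le {f : ℂ → ℂ} (hf : IsHomeoOn f (ball 0 1))
    {a b : ℝ} (hab : a < b) (hb : b < 1) :
    volume (f '' (ball 0 b \ closedBall 0 a)) ≤
      ENNReal.ofReal (volume.real (f '' ball 0 b) - volume.real (f '' ball 0 a)) := by
  have hb' : ball (0 : ℂ) b ⊆ ball 0 1 := ball_subset_ball hb.le
  have hfin : volume (f '' ball 0 b) ≠ ∞ :=
    (((isCompact_closedBall 0 b).image_of_continuousOn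
      (hf.1.mono (closedBall_subset_ball hb))).isBounded.subset
      (image_mono ball_subset_closedBall)).measure_lt_top.ne
  have hsub : f '' ball 0 a ⊆ f '' ball 0 b := image_mono (ball_subset_ball hab.le)
  have hUa : IsOpen (f '' ball 0 a) := hf.2.2 _ ((ball_subset_ball hab.le).trans hb') isOpen_ball
  rw [← measureReal_sdiff hsub hUa.measurableSet hfin, ofReal_measureReal
    (measure_ne_top_of_subset sdiff_subset hfin)]
  refine measure_mono ?_
  rintro _ ⟨z, ⟨hz, hza⟩, rfl⟩
  refine ⟨mem_image_of_mem _ hz, fun ⟨w, hw, hwz⟩ ↦ hza ?_⟩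
  rw [← hf.2.1 (hb' (ball_subset_ball hab.le hw)) (hb' hz) hwz]
  exact ball_subset_closedBall hw

theorem IsHomeoOn.rpow_le_pModulus_mul {f : ℂ → ℂ} (hf : IsHomeoOn f (ball 0 1)) {p : ℝ}
    (hp : 1 < p) {a b : ℝ} (hab : a < b) (hb : b < 1)
    (hM : pModulus p ((fun γ ↦ f ∘ γ) '' ringCurves a b) ≠ ∞) :
    ENNReal.ofReal (2 * √Real.pi * √(volume.real (f '' ball 0 a))) ^ p ≤
      pModulus p ((fun γ ↦ f ∘ γ) '' ringCurves a b) *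
        ENNReal.ofReal (volume.real (f '' ball 0 b) - volume.real (f '' ball 0 a)) ^ (p - 1) := by
  have hp' : 0 ≤ p - 1 := by linarith
  have hc : ENNReal.ofReal (volume.real (f '' ball 0 b) - volume.real (f '' ball 0 a)) ^ (p - 1) ≠
      ∞ := ENNReal.rpow_ne_top_of_nonneg hp' ENNReal.ofReal_ne_top
  have hR : IsOpen (f '' (ball 0 b \ closedBall 0 a)) :=
    hf.2.2 _ (sdiff_subset.trans (ball_subset_ball hb.le)) (isOpen_ball.sdiff isClosed_closedBall)
  rw [← ENNReal.div_le_iff_le_mul (.inr hM) (.inl hc), pModulus]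
  refine le_iInf₂ fun ρ hρ ↦ ENNReal.div_le_of_le_mul ?_
  calc _ ≤ (∫⁻ x, (f '' (ball 0 b \ closedBall 0 a)).indicator ρ x) ^ p :=
        ENNReal.rpow_le_rpow (hf.two_mul_sqrt_pi_le_lintegral hab hb hρ) (by linarith)
    _ ≤ (∫⁻ x, ρ x ^ p) * volume (f '' (ball 0 b \ closedBall 0 a)) ^ (p - 1) :=
        rpow_lintegral_indicator_le hp hρ.1 hR.measurableSet
    _ ≤ _ := by gcongr; exact hf.volume_real_add_le hab hb

theorem HasDerivAt.norm_le_norm_of_dist_le {E F : Type*} [NormedAddCommGroup E] [NormedSpace ℝ E]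
    [NormedAddCommGroup F] [NormedSpace ℝ F] {φ : ℝ → E} {γ : ℝ → F} {φ' : E} {γ' : F} {t : ℝ}
    (hφ : HasDerivAt φ φ' t) (hγ : HasDerivAt γ γ' t)
    (h : ∀ᶠ u in nhds t, ‖φ u - φ t‖ ≤ ‖γ u - γ t‖) : ‖φ'‖ ≤ ‖γ'‖ := by
  refine le_of_tendsto_of_tendsto (hasDerivAt_iff_tendsto_slope.1 hφ).norm
    (hasDerivAt_iff_tendsto_slope.1 hγ).norm ?_
  filter_upwards [h.filter_mono nhdsWithin_le_nhds] with u hu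
  simp only [slope_def_module, norm_smul]
  gcongr

theorem ofReal_sub_le_lintegral_annulus {γ : ℝ → ℂ} {K : NNReal}
    (hγ : LipschitzOnWith K γ (Icc 0 1)) {a b : ℝ} (hab : a < b) (h0 : ‖γ 0‖ ≤ a)
    (h1 : b ≤ ‖γ 1‖) :
    ENNReal.ofReal (b - a) ≤ ∫⁻ t in Icc (0 : ℝ) 1,
      {z : ℂ | a < ‖z‖ ∧ ‖z‖ < b}.indicator 1 (γ t) * (‖deriv γ t‖₊ : ℝ≥0∞) := by
  set c : ℂ → ℝ := fun z ↦ max a (min b ‖z‖) with hc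
  have hcl : LipschitzWith 1 c := (lipschitzWith_one_norm.const_min b).const_max a
  set φ : ℝ → ℝ := c ∘ γ with hφ
  have hφl : LipschitzOnWith (1 * K) φ (Icc 0 1) := hcl.comp_lipschitzOnWith hγ
  have hint : ∫ t in (0 : ℝ)..1, deriv φ t = b - a := by
    rw [AbsolutelyContinuousOnInterval.integral_deriv_eq_sub
      (LipschitzOnWith.absolutelyContinuousOnInterval (by rwa [uIcc_of_le zero_le_one]))]
    simp only [hφ, hc, Function.comp, min_eq_left h1, max_eq_right hab.le,
      max_eq_left ((min_le_right b _).trans h0)]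
  rw [intervalIntegral.integral_of_le zero_le_one] at hint
  have h2 : ENNReal.ofReal (b - a) ≤ ∫⁻ t in Ioc (0 : ℝ) 1, ‖deriv φ t‖ₑ := by
    rw [← hint]
    exact (Real.ofReal_le_enorm _).trans (enorm_integral_le_lintegral_enorm _)
  refine h2.trans ?_
  rw [setLIntegral_congr Ioo_ae_eq_Icc.symm, setLIntegral_congr Ioo_ae_eq_Ioc.symm]
  refine setLIntegral_mono_ae' measurableSet_Ioo ?_
  filter_upwards [hγ.ae_differentiableWithinAt_of_mem_real,
    hφl.ae_differentiableWithinAt_of_mem_real] with t hγt hφt ht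
  have hnhds : Icc (0 : ℝ) 1 ∈ nhds t := Icc_mem_nhds ht.1 ht.2
  have hγd := ((hγt (Ioo_subset_Icc_self ht)).differentiableAt hnhds).hasDerivAt
  have hφd := ((hφt (Ioo_subset_Icc_self ht)).differentiableAt hnhds).hasDerivAt
  by_cases hm : a < ‖γ t‖ ∧ ‖γ t‖ < b
  · have hm' : γ t ∈ {z : ℂ | a < ‖z‖ ∧ ‖z‖ < b} := hm
    rw [indicator_of_mem hm', Pi.one_apply, one_mul, enorm_eq_nnnorm, ENNReal.coe_le_coe]
    refine hφd.norm_le_norm_of_dist_le hγd (.of_forall fun u ↦ ?_)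
    simpa [dist_eq_norm, hφ] using hcl.dist_le_mul (γ u) (γ t)
  · suffices deriv φ t = 0 by simp [this]
    rcases le_or_gt ‖γ t‖ a with h | h
    · refine IsLocalMin.deriv_eq_zero (.of_forall fun u ↦ ?_)
      simp only [hφ, hc, Function.comp, max_eq_left ((min_le_right b _).trans h)]
      exact le_max_left _ _
    · have h' : b ≤ ‖γ t‖ := not_lt.1 fun h' ↦ hm ⟨h, h'⟩
      refine IsLocalMax.deriv_eq_zero (.of_forall fun u ↦ ?_)
      simp only [hφ, hc, Function.comp, min_eq_left h', max_eq_right hab.le]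
      exact max_le hab.le (min_le_left _ _)

theorem measurableSet_annulus (a b : ℝ) : MeasurableSet {z : ℂ | a < ‖z‖ ∧ ‖z‖ < b} :=
  ((isOpen_lt continuous_const continuous_norm).inter
    (isOpen_lt continuous_norm continuous_const)).measurableSet

theorem isAdmissible_annulus {a b : ℝ} (hab : a < b) :
    IsAdmissible ({z : ℂ | a < ‖z‖ ∧ ‖z‖ < b}.indicator fun _ ↦ (ENNReal.ofReal (b - a))⁻¹)
      (ringCurves a b) := by
  refine ⟨measurable_const.indicator (measurableSet_annulus a b), fun γ hγ ↦ ?_⟩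
  rw [lineIntegral]
  split_ifs with hK
  · obtain ⟨K, hK⟩ := hK
    have hpos : ENNReal.ofReal (b - a) ≠ 0 := by simpa using hab
    have h := ofReal_sub_le_lintegral_annulus hK hab (mem_closedBall_zero_iff.1 hγ.2.2.1)
      (by simpa using hγ.2.2.2)
    calc (1 : ℝ≥0∞) = (ENNReal.ofReal (b - a))⁻¹ * ENNReal.ofReal (b - a) :=
          (ENNReal.inv_mul_cancel hpos ENNReal.ofReal_ne_top).symm
      _ ≤ _ := mul_le_mul_right h _
      _ = _ := by
        rw [← lintegral_const_mul' _ _ (ENNReal.inv_ne_top.2 hpos)]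
        refine lintegral_congr fun t ↦ ?_
        by_cases ht : γ t ∈ {z : ℂ | a < ‖z‖ ∧ ‖z‖ < b} <;> simp [ht]
  · exact le_top

theorem lintegral_Ioo_neg_pi_pi (Q : ℂ → ℝ≥0∞) (r : ℝ) :
    ∫⁻ θ in Ioo (-Real.pi) Real.pi, Q (r * (Real.cos θ + Real.sin θ * Complex.I)) =
      ENNReal.ofReal (2 * Real.pi) * circleMean Q 0 r := by
  have hper : ∀ (g : AddSubgroup.zmultiples (2 * Real.pi)) (θ : ℝ),
      Q (r * Complex.exp (((g +ᵥ θ : ℝ) : ℂ) * Complex.I)) = Q (r * Complex.exp (θ * Complex.I)) := by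
    rintro ⟨_, n, rfl⟩ θ
    congr 2
    rw [Complex.exp_eq_exp_iff_exists_int]
    refine ⟨n, ?_⟩
    simp only [AddSubgroup.vadd_def, vadd_eq_add, zsmul_eq_mul]
    push_cast
    ring
  have hpi := Real.two_pi_pos
  have h := (isAddFundamentalDomain_Ioc hpi (-Real.pi)).setLIntegral_eq
    (isAddFundamentalDomain_Ioc hpi 0) (fun θ : ℝ ↦ Q (r * Complex.exp (θ * Complex.I))) hper
  rw [circleMean, ENNReal.mul_div_cancel (by simpa using Real.pi_pos) ENNReal.ofReal_ne_top,
    setLIntegral_congr Ioo_ae_eq_Ioc]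
  simp only [zero_add] at h ⊢
  rw [setLIntegral_congr Ioc_ae_eq_Icc.symm, ← h, show -Real.pi + 2 * Real.pi = Real.pi by ring]
  refine lintegral_congr fun θ ↦ ?_
  rw [Complex.exp_mul_I, Complex.ofReal_cos, Complex.ofReal_sin]

theorem setLIntegral_annulus_le {Q : ℂ → ℝ≥0∞} (hQ : Measurable Q) {q₀ : ℝ} (hq₀ : 0 ≤ q₀)
    (hq : ∀ᵐ t ∂(volume.restrict (Ioo (0 : ℝ) 1)), circleMean Q 0 t ≤ ENNReal.ofReal q₀)
    {a b : ℝ} (ha : 0 ≤ a) (hab : a ≤ b) (hb : b ≤ 1) :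
    ∫⁻ z in {z : ℂ | a < ‖z‖ ∧ ‖z‖ < b}, Q z ≤
      ENNReal.ofReal (Real.pi * q₀ * (b ^ 2 - a ^ 2)) := by
  have hm := measurableSet_annulus a b
  have hmeas : Measurable fun x : ℝ × ℝ ↦ ENNReal.ofReal x.1 •
      {z : ℂ | a < ‖z‖ ∧ ‖z‖ < b}.indicator Q (Complex.polarCoord.symm x) := by
    have : Measurable fun x : ℝ × ℝ ↦ Complex.polarCoord.symm x := by
      simp only [Complex.polarCoord_symm_apply]
      fun_prop
    exact (ENNReal.measurable_ofReal.comp measurable_fst).smul ((hQ.indicator hm).comp this)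
  rw [← lintegral_indicator hm, ← Complex.lintegral_comp_polarCoord_symm]
  change ∫⁻ x in Ioi (0 : ℝ) ×ˢ Ioo (-Real.pi) Real.pi, _ ≤ _
  rw [Measure.volume_eq_prod, ← Measure.prod_restrict, lintegral_prod _ hmeas.aemeasurable]
  have hinner : ∀ r ∈ Ioi (0 : ℝ), ∫⁻ θ in Ioo (-Real.pi) Real.pi, ENNReal.ofReal r •
      {z : ℂ | a < ‖z‖ ∧ ‖z‖ < b}.indicator Q (Complex.polarCoord.symm (r, θ)) =
      (Ioo a b).indicator (fun r ↦ ENNReal.ofReal r *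
        (ENNReal.ofReal (2 * Real.pi) * circleMean Q 0 r)) r := by
    intro r hr
    have hnorm : ∀ θ, ‖Complex.polarCoord.symm (r, θ)‖ = r := fun θ ↦ by
      rw [Complex.norm_polarCoord_symm, abs_of_pos hr]
    by_cases hrab : r ∈ Ioo a b
    · have : ∀ θ, Complex.polarCoord.symm (r, θ) ∈ {z : ℂ | a < ‖z‖ ∧ ‖z‖ < b} := fun θ ↦ by
        simpa only [mem_ofPred_eq, hnorm, mem_Ioo] using hrab
      have h : ∀ θ, {z : ℂ | a < ‖z‖ ∧ ‖z‖ < b}.indicator Q (Complex.polarCoord.symm (r, θ)) =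
          Q (Complex.polarCoord.symm (r, θ)) := fun θ ↦ indicator_of_mem (this θ) Q
      simp only [h, indicator_of_mem hrab, smul_eq_mul]
      simp only [Complex.polarCoord_symm_apply]
      rw [lintegral_const_mul' _ _ ENNReal.ofReal_ne_top, lintegral_Ioo_neg_pi_pi]
    · have : ∀ θ, Complex.polarCoord.symm (r, θ) ∉ {z : ℂ | a < ‖z‖ ∧ ‖z‖ < b} := fun θ ↦ by
        simpa only [mem_ofPred_eq, hnorm, mem_Ioo] using hrab
      simp only [indicator_of_notMem (this _), indicator_of_notMem hrab, smul_zero, lintegral_zero]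
  rw [setLIntegral_congr_fun measurableSet_Ioi hinner, lintegral_indicator measurableSet_Ioo,
    Measure.restrict_restrict measurableSet_Ioo,
    inter_eq_left.2 (Ioo_subset_Ioi_self.trans (Ioi_subset_Ioi ha))]
  have hle : ∫⁻ r in Ioo a b, ENNReal.ofReal r * (ENNReal.ofReal (2 * Real.pi) * circleMean Q 0 r) ≤
      ∫⁻ r in Ioo a b, ENNReal.ofReal (2 * Real.pi * q₀ * r) := by
    refine lintegral_mono_ae ?_
    filter_upwards [ae_restrict_of_ae_restrict_of_subset (Ioo_subset_Ioo ha hb) hq,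
      ae_restrict_mem measurableSet_Ioo] with r hr hrab
    rw [mul_comm (2 * Real.pi * q₀) r, ENNReal.ofReal_mul (ha.trans hrab.1.le),
      ENNReal.ofReal_mul Real.two_pi_pos.le]
    gcongr
  refine hle.trans_eq ?_
  have hint : IntegrableOn (fun r : ℝ ↦ 2 * Real.pi * q₀ * r) (Ioo a b) :=
    ((by fun_prop : Continuous fun r : ℝ ↦ 2 * Real.pi * q₀ * r).integrableOn_Icc).mono_set
      Ioo_subset_Icc_self
  rw [← ofReal_integral_eq_lintegral_ofReal hint, ← integral_Ioc_eq_integral_Ioo,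
    ← intervalIntegral.integral_of_le hab, intervalIntegral.integral_const_mul, integral_id]
  · congr 1
    ring
  · filter_upwards [ae_restrict_mem measurableSet_Ioo] with r hr
    have := ha.trans hr.1.le
    simp only [Pi.zero_apply]
    positivity

theorem IsQHomeo.pModulus_ringCurves_le {p : ℝ} (hp : 0 < p) {f : ℂ → ℂ} {Q : ℂ → ℝ≥0∞}
    (hf : IsQHomeo p (ball 0 1) Q f) (hQ : Measurable Q) {q₀ : ℝ} (hq₀ : 0 ≤ q₀)
    (hq : ∀ᵐ t ∂(volume.restrict (Ioo (0 : ℝ) 1)), circleMean Q 0 t ≤ ENNReal.ofReal q₀)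
    {a b : ℝ} (ha : 0 ≤ a) (hab : a < b) (hb : b ≤ 1) :
    pModulus p ((fun γ ↦ f ∘ γ) '' ringCurves a b) ≤
      ENNReal.ofReal (Real.pi * q₀ * (b ^ 2 - a ^ 2) / (b - a) ^ p) := by
  have hm := measurableSet_annulus a b
  have hpos : 0 < (b - a) ^ p := Real.rpow_pos_of_pos (sub_pos.2 hab) p
  have hpos' : ENNReal.ofReal (b - a) ≠ 0 := by simpa using hab
  calc _ ≤ ∫⁻ z in ball 0 1, Q z * ({z : ℂ | a < ‖z‖ ∧ ‖z‖ < b}.indicator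
            (fun _ ↦ (ENNReal.ofReal (b - a))⁻¹) z) ^ p :=
        hf.2 _ (fun γ hγ ↦ ⟨hγ.1, hγ.2.1⟩) _ (isAdmissible_annulus hab)
    _ ≤ ∫⁻ z, Q z * ({z : ℂ | a < ‖z‖ ∧ ‖z‖ < b}.indicator
            (fun _ ↦ (ENNReal.ofReal (b - a))⁻¹) z) ^ p := setLIntegral_le_lintegral _ _
    _ = ∫⁻ z in {z : ℂ | a < ‖z‖ ∧ ‖z‖ < b}, Q z * (ENNReal.ofReal (b - a))⁻¹ ^ p := by
        rw [← lintegral_indicator hm]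
        refine lintegral_congr fun z ↦ ?_
        by_cases hz : z ∈ {z : ℂ | a < ‖z‖ ∧ ‖z‖ < b}
        · rw [indicator_of_mem hz, indicator_of_mem hz]
        · rw [indicator_of_notMem hz, indicator_of_notMem hz, ENNReal.zero_rpow_of_pos hp, mul_zero]
    _ = (∫⁻ z in {z : ℂ | a < ‖z‖ ∧ ‖z‖ < b}, Q z) * (ENNReal.ofReal (b - a))⁻¹ ^ p :=
        lintegral_mul_const _ hQ
    _ ≤ ENNReal.ofReal (Real.pi * q₀ * (b ^ 2 - a ^ 2)) * (ENNReal.ofReal (b - a))⁻¹ ^ p := by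
        gcongr
        exact setLIntegral_annulus_le hQ hq₀ hq ha hab.le hb
    _ = _ := by
        rw [ENNReal.inv_rpow, ENNReal.ofReal_rpow_of_pos (sub_pos.2 hab), ← div_eq_mul_inv,
          ENNReal.ofReal_div_of_pos hpos]

theorem MonotoneOn.sub_le_sub_of_exists_Ioc {u g : ℝ → ℝ} {a r : ℝ} (har : a ≤ r)
    (hu : MonotoneOn u (Icc a r)) (hg : ContinuousOn g (Icc a r))
    (h : ∀ t ∈ Ico a r, ∃ t' ∈ Ioc t r, g t' - g t ≤ u t' - u t) :
    g r - g a ≤ u r - u a := by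
  set A : Set ℝ := {t | t ∈ Icc a r ∧ g t - g a ≤ u t - u a} with hA
  have haA : a ∈ A := ⟨left_mem_Icc.2 har, by simp⟩
  have hAr : BddAbove A := ⟨r, fun t ht ↦ ht.1.2⟩
  have hTmem : sSup A ∈ Icc a r := ⟨le_csSup hAr haA, csSup_le ⟨a, haA⟩ fun t ht ↦ ht.1.2⟩
  have hclosed : IsClosed (Icc a r ∩ g ⁻¹' Iic (u (sSup A) - u a + g a)) :=
    hg.preimage_isClosed_of_isClosed isClosed_Icc isClosed_Iic
  have hsub : A ⊆ Icc a r ∩ g ⁻¹' Iic (u (sSup A) - u a + g a) := fun t ht ↦ by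
    refine ⟨ht.1, ?_⟩
    have := hu ht.1 hTmem (le_csSup hAr ht)
    have := ht.2
    rw [mem_preimage, mem_Iic]
    linarith
  have hT := (hclosed.closure_subset_iff.2 hsub (csSup_mem_closure ⟨a, haA⟩ hAr)).2
  rw [mem_preimage, mem_Iic] at hT
  rcases hTmem.2.eq_or_lt with hTr | hTr
  · rw [hTr] at hT
    linarith
  · obtain ⟨t', ht', hle⟩ := h _ ⟨hTmem.1, hTr⟩
    refine absurd (le_csSup hAr (show t' ∈ A from ⟨⟨hTmem.1.trans ht'.1.le, ht'.2⟩, ?_⟩)) ht'.1.not_ge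
    linarith

theorem HasDerivAt.eventually_nhdsGT_lt {f : ℝ → ℝ} {f' x : ℝ} (hf : HasDerivAt f f' x)
    (hf' : 0 < f') : ∀ᶠ y in nhdsWithin x (Ioi x), f x < f y := by
  have h := ((hasDerivAt_iff_tendsto_slope.1 hf).mono_left
    (nhdsWithin_mono x fun y (hy : x < y) ↦ hy.ne')).eventually (eventually_gt_nhds hf')
  filter_upwards [h, self_mem_nhdsWithin] with y hy hxy
  rw [slope_def_field, div_pos_iff_of_pos_right (sub_pos.2 hxy)] at hy
  exact sub_pos.1 hy

theorem exists_rpow_sub_le_rpow_sub {p : ℝ} (hp : 2 < p) {s : ℝ → ℝ}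
    (hpos : ∀ t ∈ Ioo (0 : ℝ) 1, 0 < s t) (hmono : MonotoneOn s (Ioo 0 1))
    (h : ∀ a b : ℝ, 0 < a → a < b → b < 1 →
      2 ^ p * s a ^ (p / 2) * (b - a) ^ (p - 1) ≤ (a + b) * (s b - s a) ^ (p - 1))
    {η : ℝ} (hη : 0 < η) {t r : ℝ} (ht : 0 < t) (htr : t < r) (hr : r < 1) :
    ∃ t' ∈ Ioc t r, (1 - η) * t' ^ ((p - 2) / (p - 1)) - (1 - η) * t ^ ((p - 2) / (p - 1)) ≤
      s t' ^ ((p - 2) / (p - 1) / 2) - s t ^ ((p - 2) / (p - 1) / 2) := by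
  set β := (p - 2) / (p - 1) with hβ
  have hp1 : 0 < p - 1 := by linarith
  have hβ0 : 0 < β := div_pos (by linarith) hp1
  have hst := hpos t ⟨ht, htr.trans hr⟩
  set w : ℝ → ℝ := fun x ↦ (2 ^ p * s t ^ (p / 2) / (t + x)) ^ (1 / (p - 1)) with hw
  have hcpos : 0 < 2 ^ p * s t ^ (p / 2) := by positivity
  have hwd : DifferentiableAt ℝ w t := by
    refine DifferentiableAt.rpow_const ?_ (Or.inl (by positivity))
    exact (differentiableAt_const _).div (by fun_prop) (by positivity)
  have hD : HasDerivAt (fun x ↦ s t + (x - t) * w x) (w t) t := by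
    simpa using (((hasDerivAt_id t).sub_const t).mul hwd.hasDerivAt).const_add (s t)
  have hDβ := hD.rpow_const (p := β / 2) (Or.inl (by simpa using hst.ne'))
  have hG := ((hasDerivAt_id t).rpow_const (p := β) (Or.inl ht.ne')).const_mul (1 - η)
  have hval : w t * (β / 2) * (s t + (t - t) * w t) ^ (β / 2 - 1) = β * t ^ (β - 1) := by
    have h1 : w t = 2 * s t ^ (p / 2 / (p - 1)) * t ^ (-(1 / (p - 1))) := by
      have : 2 ^ p * s t ^ (p / 2) / (t + t) = 2 ^ (p - 1) * s t ^ (p / 2) * t⁻¹ := by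
        rw [Real.rpow_sub_one two_ne_zero]
        field_simp
        ring
      simp only [hw]
      rw [this, Real.mul_rpow (by positivity) (by positivity), Real.mul_rpow (by positivity)
        (by positivity), ← Real.rpow_mul zero_le_two, ← Real.rpow_mul hst.le,
        Real.inv_rpow ht.le, Real.rpow_neg ht.le, mul_one_div_cancel hp1.ne', Real.rpow_one,
        mul_one_div]
    have h2 : s t ^ (p / 2 / (p - 1)) * s t ^ (β / 2 - 1) = 1 := by
      rw [← Real.rpow_add hst, show p / 2 / (p - 1) + (β / 2 - 1) = 0 by
        rw [hβ]; field_simp; ring, Real.rpow_zero]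
    have h3 : -(1 / (p - 1)) = β - 1 := by rw [hβ]; field_simp; ring
    rw [sub_self, zero_mul, add_zero, h1, h3]
    linear_combination (β * t ^ (β - 1)) * h2
  have hK := hDβ.sub hG
  have hK' := hK.eventually_nhdsGT_lt (by
    rw [hval]
    have : 0 < η * (β * t ^ (β - 1)) := by positivity
    simp only [id, one_mul]
    linarith)
  obtain ⟨t', hlt, ht't⟩ := (hK'.and (Ioc_mem_nhdsGT htr)).exists
  refine ⟨t', ht't, ?_⟩
  have ht'1 : t' < 1 := ht't.2.trans_lt hr
  have hle : s t + (t' - t) * w t' ≤ s t' := by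
    have hΔ : 0 ≤ s t' - s t := sub_nonneg.2
      (hmono ⟨ht, htr.trans hr⟩ ⟨ht.trans ht't.1, ht'1⟩ ht't.1.le)
    have hd : 0 < t' - t := sub_pos.2 ht't.1
    have hsum : 0 < t + t' := by linarith [ht't.1]
    have h1 := h t t' ht ht't.1 ht'1
    have h2 : 2 ^ p * s t ^ (p / 2) / (t + t') ≤ ((s t' - s t) / (t' - t)) ^ (p - 1) := by
      rw [Real.div_rpow hΔ hd.le, div_le_div_iff₀ hsum (by positivity)]
      linarith
    have h3 : w t' ≤ (s t' - s t) / (t' - t) := by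
      have := Real.rpow_le_rpow (by positivity) h2 (one_div_pos.2 hp1).le
      rwa [← Real.rpow_mul (by positivity), mul_one_div_cancel hp1.ne', Real.rpow_one] at this
    rw [le_div_iff₀ hd] at h3
    linarith
  have hpos' : 0 ≤ s t + (t' - t) * w t' := by
    have : 0 ≤ w t' := Real.rpow_nonneg (div_nonneg hcpos.le (by linarith [ht't.1])) _
    have := mul_nonneg (sub_nonneg.2 ht't.1.le) this
    linarith
  have := Real.rpow_le_rpow hpos' hle (by positivity : 0 ≤ β / 2)
  simp only [Pi.sub_apply, sub_self, zero_mul, add_zero, id] at hlt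
  linarith

theorem sq_le_of_forall_rpow_le {p : ℝ} (hp : 2 < p) {s : ℝ → ℝ}
    (hpos : ∀ t ∈ Ioo (0 : ℝ) 1, 0 < s t) (hmono : MonotoneOn s (Ioo 0 1))
    (h : ∀ a b : ℝ, 0 < a → a < b → b < 1 →
      2 ^ p * s a ^ (p / 2) * (b - a) ^ (p - 1) ≤ (a + b) * (s b - s a) ^ (p - 1))
    {r : ℝ} (hr : r ∈ Ioo (0 : ℝ) 1) : r ^ 2 ≤ s r := by
  set β := (p - 2) / (p - 1) with hβ
  have hp1 : 0 < p - 1 := by linarith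
  have hβ0 : 0 < β := div_pos (by linarith) hp1
  have hsr := hpos r hr
  have key : ∀ η > 0, ∀ a ∈ Ioo 0 r, (1 - η) * r ^ β - (1 - η) * a ^ β ≤ s r ^ (β / 2) := by
    intro η hη a ha
    have hsub : Icc a r ⊆ Ioo 0 1 := fun x hx ↦ ⟨ha.1.trans_le hx.1, hx.2.trans_lt hr.2⟩
    have hu : MonotoneOn (fun t ↦ s t ^ (β / 2)) (Icc a r) := fun x hx y hy hxy ↦
      Real.rpow_le_rpow (hpos x (hsub hx)).le (hmono (hsub hx) (hsub hy) hxy) (by positivity)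
    have := hu.sub_le_sub_of_exists_Ioc ha.2.le (g := fun t ↦ (1 - η) * t ^ β)
      ((Real.continuous_rpow_const hβ0.le).const_mul _).continuousOn
      fun t ht ↦ exists_rpow_sub_le_rpow_sub hp hpos hmono h hη (ha.1.trans_le ht.1) ht.2 hr.2
    have := Real.rpow_nonneg (hpos a (hsub (left_mem_Icc.2 ha.2.le))).le (β / 2)
    linarith
  have key2 : ∀ η > 0, (1 - η) * r ^ β ≤ s r ^ (β / 2) := by
    intro η hη
    have hc : Continuous fun a : ℝ ↦ (1 - η) * r ^ β - (1 - η) * a ^ β :=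
      continuous_const.sub ((Real.continuous_rpow_const hβ0.le).const_mul _)
    have hlim := (hc.tendsto 0).mono_left (nhdsWithin_le_nhds (s := Ioi 0))
    rw [Real.zero_rpow hβ0.ne', mul_zero, sub_zero] at hlim
    refine le_of_tendsto hlim ?_
    filter_upwards [Ioo_mem_nhdsGT hr.1] with a ha using key η hη a ha
  have key3 : r ^ β ≤ s r ^ (β / 2) := by
    have hc : Continuous fun η : ℝ ↦ (1 - η) * r ^ β := by fun_prop
    have hlim := (hc.tendsto 0).mono_left (nhdsWithin_le_nhds (s := Ioi 0))
    rw [sub_zero, one_mul] at hlim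
    refine le_of_tendsto hlim ?_
    filter_upwards [self_mem_nhdsWithin] with η hη using key2 η hη
  have h4 := Real.rpow_le_rpow (Real.rpow_nonneg hr.1.le β) key3 (by positivity : 0 ≤ 2 / β)
  rw [← Real.rpow_mul hr.1.le, ← Real.rpow_mul hsr.le, mul_div_cancel₀ _ hβ0.ne',
    show β / 2 * (2 / β) = 1 by field_simp, Real.rpow_one] at h4
  exact_mod_cast h4

theorem IsHomeoOn.volume_image_ball_ne_top {f : ℂ → ℂ} (hf : IsHomeoOn f (ball 0 1)) {t : ℝ}
    (ht : t < 1) : volume (f '' ball 0 t) ≠ ∞ :=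
  (((isCompact_closedBall 0 t).image_of_continuousOn
    (hf.1.mono (closedBall_subset_ball ht))).isBounded.subset
    (image_mono ball_subset_closedBall)).measure_lt_top.ne

theorem IsHomeoOn.volume_real_image_ball_pos {f : ℂ → ℂ} (hf : IsHomeoOn f (ball 0 1)) {t : ℝ}
    (ht : t ∈ Ioo (0 : ℝ) 1) : 0 < volume.real (f '' ball 0 t) :=
  ENNReal.toReal_pos ((hf.2.2 _ (ball_subset_ball ht.2.le) isOpen_ball).measure_pos volume
    ((nonempty_ball.2 ht.1).image f)).ne' (hf.volume_image_ball_ne_top ht.2)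

theorem IsQHomeo.ofReal_le_volume_image_ball {p : ℝ} (hp : 2 < p) {f : ℂ → ℂ} {Q : ℂ → ℝ≥0∞}
    (hf : IsQHomeo p (ball 0 1) Q f) (hQ : Measurable Q) {q₀ : ℝ} (hq₀ : 0 < q₀)
    (hq : ∀ᵐ t ∂(volume.restrict (Ioo (0 : ℝ) 1)), circleMean Q 0 t ≤ ENNReal.ofReal q₀)
    {r : ℝ} (hr : r ∈ Ioo (0 : ℝ) 1) :
    ENNReal.ofReal (Real.pi * q₀ ^ (2 / (2 - p)) * r ^ 2) ≤ volume (f '' ball 0 r) := by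
  set c := Real.pi * q₀ ^ (2 / (2 - p)) with hc
  have hcpos : 0 < c := by positivity
  have hp1 : 0 < p - 1 := by linarith
  set S : ℝ → ℝ := fun t ↦ volume.real (f '' ball 0 t) with hS
  have hSpos : ∀ t ∈ Ioo (0 : ℝ) 1, 0 < S t := fun t ht ↦ hf.1.volume_real_image_ball_pos ht
  have hSmono : MonotoneOn S (Ioo 0 1) := fun a _ b hb hab ↦
    measureReal_mono (image_mono (ball_subset_ball hab)) (hf.1.volume_image_ball_ne_top hb.2)
  have key : ∀ a b : ℝ, 0 < a → a < b → b < 1 →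
      2 ^ p * (S a / c) ^ (p / 2) * (b - a) ^ (p - 1) ≤
        (a + b) * (S b / c - S a / c) ^ (p - 1) := by
    intro a b ha hab hb
    have hSa := hSpos a ⟨ha, hab.trans hb⟩
    have hSb := hSpos b ⟨ha.trans hab, hb⟩
    have hd : 0 < b - a := sub_pos.2 hab
    have hΔ : 0 ≤ S b - S a :=
      sub_nonneg.2 (hSmono ⟨ha, hab.trans hb⟩ ⟨ha.trans hab, hb⟩ hab.le)
    have hM := hf.pModulus_ringCurves_le (by linarith) hQ hq₀.le hq ha.le hab hb.le
    have h1 := (hf.1.rpow_le_pModulus_mul (by linarith) hab hb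
      (hM.trans_lt ENNReal.ofReal_lt_top).ne).trans (mul_le_mul_left hM _)
    have hba : 0 ≤ b ^ 2 - a ^ 2 := by nlinarith
    rw [ENNReal.ofReal_rpow_of_nonneg (by positivity) (by linarith),
      ENNReal.ofReal_rpow_of_nonneg hΔ hp1.le, ← ENNReal.ofReal_mul (by positivity),
      ENNReal.ofReal_le_ofReal_iff (by positivity)] at h1
    change (2 * √Real.pi * √(S a)) ^ p ≤ _ * (S b - S a) ^ (p - 1) at h1
    have hbp : (b - a) ^ p = (b - a) * (b - a) ^ (p - 1) := by
      rw [Real.rpow_sub_one hd.ne']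
      field_simp
    have hlhs : (2 * √Real.pi * √(S a)) ^ p = 2 ^ p * Real.pi ^ (p / 2) * S a ^ (p / 2) := by
      rw [Real.mul_rpow (by positivity) (by positivity), Real.mul_rpow (by positivity)
        (by positivity), Real.sqrt_eq_rpow, Real.sqrt_eq_rpow, ← Real.rpow_mul Real.pi_pos.le,
        ← Real.rpow_mul hSa.le, one_div_mul_eq_div]
    have hcc : c ^ (p - 1) * (Real.pi * q₀) = Real.pi ^ (p / 2) * c ^ (p / 2) := by
      have h2 : c ^ (p - 1) = c ^ (p / 2) * c ^ (p / 2 - 1) := by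
        rw [← Real.rpow_add hcpos]
        congr 1
        ring
      have h3 : c ^ (p / 2 - 1) = Real.pi ^ (p / 2 - 1) * q₀⁻¹ := by
        have : 2 - p ≠ 0 := by linarith
        rw [hc, Real.mul_rpow (by positivity) (by positivity), ← Real.rpow_mul hq₀.le,
          show 2 / (2 - p) * (p / 2 - 1) = -1 by field_simp; ring, Real.rpow_neg_one]
      rw [h2, h3, Real.rpow_sub_one Real.pi_pos.ne']
      field_simp
    rw [hlhs, hbp, div_mul_eq_mul_div, le_div_iff₀ (by positivity)] at h1
    rw [← sub_div, Real.div_rpow hSa.le hcpos.le, Real.div_rpow hΔ hcpos.le]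
    have h4 : 2 ^ p * Real.pi ^ (p / 2) * S a ^ (p / 2) * (b - a) ^ (p - 1) ≤
        Real.pi * q₀ * (a + b) * (S b - S a) ^ (p - 1) := by
      refine le_of_mul_le_mul_left ?_ hd
      linarith
    rw [mul_div_assoc', mul_div_assoc', div_mul_eq_mul_div, div_le_div_iff₀ (by positivity)
      (by positivity)]
    have hpp : 0 < Real.pi ^ (p / 2) := by positivity
    refine le_of_mul_le_mul_left ?_ hpp
    calc _ = c ^ (p - 1) *
          (2 ^ p * Real.pi ^ (p / 2) * S a ^ (p / 2) * (b - a) ^ (p - 1)) := by ring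
      _ ≤ c ^ (p - 1) * (Real.pi * q₀ * (a + b) * (S b - S a) ^ (p - 1)) := by gcongr
      _ = (c ^ (p - 1) * (Real.pi * q₀)) * ((a + b) * (S b - S a) ^ (p - 1)) := by ring
      _ = _ := by rw [hcc]; ring
  have h := sq_le_of_forall_rpow_le hp (fun t ht ↦ div_pos (hSpos t ht) hcpos)
    (fun a ha b hb hab ↦ div_le_div_of_nonneg_right (hSmono ha hb hab) hcpos.le) key hr
  rw [le_div_iff₀ hcpos, mul_comm] at h
  rw [← ofReal_measureReal (hf.1.volume_image_ball_ne_top hr.2)]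
  exact ENNReal.ofReal_le_ofReal h

theorem IsQHomeo.ofReal_le_volume_image_closedBall {p : ℝ} (hp : 2 < p) {f : ℂ → ℂ}
    {Q : ℂ → ℝ≥0∞} (hf : IsQHomeo p (ball 0 1) Q f) (hQ : Measurable Q) {q₀ : ℝ} (hq₀ : 0 < q₀)
    (hq : ∀ᵐ t ∂(volume.restrict (Ioo (0 : ℝ) 1)), circleMean Q 0 t ≤ ENNReal.ofReal q₀)
    {r : ℝ} (hr : r ∈ Icc (0 : ℝ) 1) :
    ENNReal.ofReal (Real.pi * q₀ ^ (2 / (2 - p)) * r ^ 2) ≤ volume (f '' closedBall 0 r) := by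
  rcases hr.1.eq_or_lt with rfl | hr0
  · simp
  have hlim : Filter.Tendsto (fun t : ℝ ↦ ENNReal.ofReal (Real.pi * q₀ ^ (2 / (2 - p)) * t ^ 2))
      (nhdsWithin r (Iio r)) (nhds (ENNReal.ofReal (Real.pi * q₀ ^ (2 / (2 - p)) * r ^ 2))) :=
    ((ENNReal.continuous_ofReal.comp (by fun_prop)).tendsto r).mono_left nhdsWithin_le_nhds
  refine le_of_tendsto hlim ?_
  filter_upwards [Ioo_mem_nhdsLT hr0] with t ht
  exact (hf.ofReal_le_volume_image_ball hp hQ hq₀ hq ⟨ht.1, ht.2.trans_le hr.2⟩).trans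
    (measure_mono (image_mono (ball_subset_closedBall.trans (closedBall_subset_closedBall ht.2.le))))

theorem IsAdmissible.pModulus_le {p : ℝ} {ρ : ℂ → ℝ≥0∞} {Γ : Set (ℝ → ℂ)}
    (hρ : IsAdmissible ρ Γ) : pModulus p Γ ≤ ∫⁻ z : ℂ, ρ z ^ p :=
  iInf₂_le ρ hρ

theorem isHomeoOn_const_mul {c : ℂ} (hc : c ≠ 0) (D : Set ℂ) : IsHomeoOn (fun z ↦ c * z) D :=
  ⟨(continuous_const_mul c).continuousOn, (mul_right_injective₀ hc).injOn,
    fun _ _ hU ↦ (Homeomorph.mulLeft₀ c hc).isOpenMap _ hU⟩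

theorem le_lineIntegral_const_mul {c : ℝ} (hc : 0 < c) {D : Set ℂ} {γ : ℝ → ℂ}
    (hγ : ∀ t ∈ Icc (0 : ℝ) 1, γ t ∈ D) (ρ : ℂ → ℝ≥0∞) :
    lineIntegral ρ γ ≤ lineIntegral (fun w ↦ ENNReal.ofReal c⁻¹ * D.indicator ρ (c⁻¹ • w))
      ((fun z : ℂ ↦ c * z) ∘ γ) := by
  have hcγ : ∀ t, c⁻¹ • ((c : ℂ) * γ t) = γ t := fun t ↦ by
    rw [← Complex.real_smul, inv_smul_smul₀ hc.ne']
  rw [lineIntegral, lineIntegral]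
  split_ifs with h1 h2 h2
  · refine setLIntegral_mono' measurableSet_Icc fun t ht ↦ le_of_eq ?_
    have hd : deriv ((fun z : ℂ ↦ c * z) ∘ γ) t = c * deriv γ t := deriv_const_mul_field _
    have hn : (‖(c : ℂ)‖₊ : ℝ≥0∞) = ENNReal.ofReal c := by
      rw [← enorm_eq_nnnorm, ← ofReal_norm, Complex.norm_of_nonneg hc.le]
    have hone : ENNReal.ofReal c⁻¹ * ENNReal.ofReal c = 1 := by
      rw [← ENNReal.ofReal_mul (inv_pos.2 hc).le, inv_mul_cancel₀ hc.ne', ENNReal.ofReal_one]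
    rw [hd, nnnorm_mul, Function.comp, hcγ, indicator_of_mem (hγ t ht), ENNReal.coe_mul, hn,
      mul_mul_mul_comm, hone, one_mul]
  · exact le_top
  · obtain ⟨K, hK⟩ := h2
    have h := (lipschitzWith_smul c⁻¹ (β := ℂ)).comp_lipschitzOnWith hK
    rw [show (fun x ↦ c⁻¹ • x) ∘ (fun z : ℂ ↦ c * z) ∘ γ = γ from funext hcγ] at h
    exact absurd ⟨_, h⟩ h1
  · exact le_rfl

theorem lintegral_comp_inv_smul {c : ℝ} (hc : 0 < c) {g : ℂ → ℝ≥0∞} (hg : Measurable g) :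
    ∫⁻ w : ℂ, g (c⁻¹ • w) = ENNReal.ofReal (c ^ 2) * ∫⁻ z, g z := by
  rw [← lintegral_map hg (measurable_const_smul c⁻¹),
    Measure.map_addHaar_smul volume (inv_ne_zero hc.ne'), lintegral_smul_measure,
    Complex.finrank_real_complex, inv_pow, inv_inv, abs_of_pos (by positivity), smul_eq_mul]

theorem isQHomeo_const_mul {p : ℝ} (hp : 0 < p) {c : ℝ} (hc : 0 < c) {D : Set ℂ}
    (hD : MeasurableSet D) :
    IsQHomeo p D (fun _ ↦ ENNReal.ofReal (c ^ (2 - p))) fun z : ℂ ↦ (c : ℂ) * z := by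
  refine ⟨isHomeoOn_const_mul (by exact_mod_cast hc.ne') D, fun Γ hΓ ρ hρ ↦ ?_⟩
  have hind : Measurable (D.indicator ρ) := hρ.1.indicator hD
  have hsmul : Measurable fun w : ℂ ↦ D.indicator ρ (c⁻¹ • w) :=
    hind.comp (measurable_const_smul c⁻¹)
  have hadm : IsAdmissible (fun w ↦ ENNReal.ofReal c⁻¹ * D.indicator ρ (c⁻¹ • w))
      ((fun γ ↦ (fun z : ℂ ↦ (c : ℂ) * z) ∘ γ) '' Γ) := by
    refine ⟨hsmul.const_mul _, ?_⟩
    rintro _ ⟨γ, hγ, rfl⟩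
    exact (hρ.2 γ hγ).trans (le_lineIntegral_const_mul hc (hΓ γ hγ).2 ρ)
  refine hadm.pModulus_le.trans_eq ?_
  have hpow : ∀ z, D.indicator ρ z ^ p = D.indicator (fun z ↦ ρ z ^ p) z := fun z ↦ by
    by_cases hz : z ∈ D <;> simp [hz, hp]
  simp only [ENNReal.mul_rpow_of_nonneg _ _ hp.le]
  rw [lintegral_const_mul _ (hsmul.pow_const p),
    lintegral_comp_inv_smul hc (g := fun z ↦ D.indicator ρ z ^ p) (hind.pow_const p),
    lintegral_const_mul _ (hρ.1.pow_const p), ← mul_assoc]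
  simp only [hpow]
  rw [lintegral_indicator hD, ENNReal.ofReal_rpow_of_pos (inv_pos.2 hc),
    ← ENNReal.ofReal_mul (by positivity), Real.inv_rpow hc.le, Real.rpow_sub hc, Real.rpow_two,
    inv_mul_eq_div]

theorem circleMean_const (q : ℝ≥0∞) (z : ℂ) (r : ℝ) : circleMean (fun _ ↦ q) z r = q := by
  rw [circleMean, setLIntegral_const, Real.volume_Icc, sub_zero,
    ENNReal.mul_div_cancel_right (by simpa using Real.pi_pos) ENNReal.ofReal_ne_top]

theorem volume_image_const_mul_closedBall {c r : ℝ} (hc : 0 ≤ c) (hr : 0 ≤ r) :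
    volume ((fun z : ℂ ↦ (c : ℂ) * z) '' closedBall 0 r) =
      ENNReal.ofReal (Real.pi * c ^ 2 * r ^ 2) := by
  have h : (fun z : ℂ ↦ (c : ℂ) * z) '' closedBall 0 r = closedBall 0 (c * r) := by
    simp_rw [← Complex.real_smul]
    rw [image_smul, smul_closedBall _ _ hr, smul_zero, Real.norm_of_nonneg hc]
  rw [h, Complex.volume_closedBall, ← ENNReal.ofReal_pow (by positivity), ← ofReal_coe_nnreal,
    ← ENNReal.ofReal_mul (by positivity), NNReal.coe_real_pi]
  congr 1
  ring

/-- **Theorem 2.** On the class `ℋ(q₀, p, 𝔹)` of `Q`-homeomorphisms `f : 𝔹 → ℂ` w.r.t. the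
`p`-modulus, `p > 2`, with `q(t) ≤ q₀` a.e. on `(0,1)`, the area functional
`S_r(f) = |fB_r|` attains the minimum `π q₀^{2/(2-p)} r²` for every `r ∈ [0,1]`,
and the minimum is attained by the linear mapping `f₀(z) = q₀^{1/(2-p)} z`. -/
theorem min_area_functional
    (p : ℝ) (hp : 2 < p) (q₀ : ℝ) (hq₀ : 0 < q₀)
    (r : ℝ) (hr : r ∈ Set.Icc (0 : ℝ) 1) :
    IsLeast
        {s : ℝ≥0∞ | ∃ (f : ℂ → ℂ) (Q : ℂ → ℝ≥0∞), Measurable Q ∧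
          IsQHomeo p (Metric.ball (0 : ℂ) 1) Q f ∧
          (∀ᵐ t ∂(volume.restrict (Set.Ioo (0 : ℝ) 1)),
            circleMean Q 0 t ≤ ENNReal.ofReal q₀) ∧
          s = volume (f '' Metric.closedBall (0 : ℂ) r)}
        (ENNReal.ofReal (Real.pi * q₀ ^ (2 / (2 - p)) * r ^ 2)) ∧
      IsQHomeo p (Metric.ball (0 : ℂ) 1) (fun _ => ENNReal.ofReal q₀)
        (fun z : ℂ => ((q₀ ^ (1 / (2 - p)) : ℝ) : ℂ) * z) ∧
      volume ((fun z : ℂ => ((q₀ ^ (1 / (2 - p)) : ℝ) : ℂ) * z) ''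
          Metric.closedBall (0 : ℂ) r) =
        ENNReal.ofReal (Real.pi * q₀ ^ (2 / (2 - p)) * r ^ 2) := by
  have hp2 : 2 - p ≠ 0 := by linarith
  set c := q₀ ^ (1 / (2 - p)) with hc
  have hcpos : 0 < c := by positivity
  have hcq : c ^ (2 - p) = q₀ := by
    rw [hc, ← Real.rpow_mul hq₀.le, one_div_mul_cancel hp2, Real.rpow_one]
  have hc2 : c ^ 2 = q₀ ^ (2 / (2 - p)) := by
    rw [← Real.rpow_natCast, hc, ← Real.rpow_mul hq₀.le, Nat.cast_ofNat, one_div_mul_eq_div]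
  have hQ := isQHomeo_const_mul (p := p) (by linarith) hcpos
    (measurableSet_ball (x := (0 : ℂ)) (ε := 1))
  rw [hcq] at hQ
  have hvol := volume_image_const_mul_closedBall hcpos.le hr.1
  rw [hc2] at hvol
  refine ⟨⟨⟨_, _, measurable_const, hQ, ?_, hvol.symm⟩, ?_⟩, hQ, hvol⟩
  · exact .of_forall fun t ↦ (circleMean_const _ _ _).le
  · rintro _ ⟨f, Q, hQm, hf, hq, rfl⟩
    exact hf.ofReal_le_volume_image_closedBall hp hQm hq₀ hq hr
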